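/- arXiv:2303.11524 — 6 statements merged into one kernel-verified Lean document; each statement's English description precedes it below -/
import Mathlib

section
/- Let d ≥ 1, let κ_1,…,κ_d > 0, and let λ_κ = Σ_{j=1}^d κ_j. Then for every t > 0, every y ∈ ℝ^d, and every x ∈ ℝ^d with x_j ≠ 0 for all j, the heat kernel h_t of the Dunkl harmonic oscillator satisfies −Δ_κ(log h_t(·,y))(x) ≤ (d + 2λ_κ) coth(2t) ≤ (d + 2λ_κ)(1 + 1/(2t)). -/
open Real MeasureTheory

/-- Partial derivative `∂f/∂x_j` at `x`. -/
noncomputable def pd {d : ℕ} (f : (Fin d → ℝ) → ℝ) (j : Fin d) (x : Fin d → ℝ) : ℝ :=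
  deriv (fun s => f (Function.update x j s)) (x j)

/-- The `ℤ₂^d` Dunkl Laplacian
`Δ_κ f(x) = Σ_j [ ∂²_j f(x) + (κ_j/x_j²)(2 x_j ∂_j f(x) − f(x) + f(σ_j x)) ]`,
where `σ_j` flips the sign of the `j`-th coordinate. -/
noncomputable def dunklLapZ2 {d : ℕ} (κ : Fin d → ℝ) (f : (Fin d → ℝ) → ℝ)
    (x : Fin d → ℝ) : ℝ :=
  ∑ j, (pd (fun z => pd f j z) j x
    + κ j / (x j) ^ 2 * (2 * x j * pd f j x - f x + f (Function.update x j (-(x j)))))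

/-- The one-dimensional kernel
`h_t^{(κ)}(u,v) = c_κ sinh(2t)^{−(κ+1/2)} exp(−(1/2) coth(2t)(u²+v²))
  ∫_{−1}^{1} (1−s)^{κ−1}(1+s)^{κ} exp(uvs/sinh(2t)) ds`,
with `c_κ⁻¹ = 2^{κ+1/2} √π Γ(κ+1/2)`. -/
noncomputable def hKer (κ t u v : ℝ) : ℝ :=
  ((2 : ℝ) ^ (κ + 1/2) * Real.sqrt π * Real.Gamma (κ + 1/2))⁻¹
    * Real.sinh (2*t) ^ (-(κ + 1/2))
    * Real.exp (-(1/2) * (Real.cosh (2*t) / Real.sinh (2*t)) * (u^2 + v^2))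
    * ∫ s in (-1 : ℝ)..(1 : ℝ),
        (1 - s) ^ (κ - 1) * (1 + s) ^ κ * Real.exp (u * v * s / Real.sinh (2*t))

/-- The heat kernel of the Dunkl harmonic oscillator in the `ℤ₂^d` case:
`h_t(x,y) = ∏_j h_t^{(κ_j)}(x_j,y_j)`. -/
noncomputable def hHeat {d : ℕ} (κ : Fin d → ℝ) (t : ℝ) (x y : Fin d → ℝ) : ℝ :=
  ∏ j, hKer (κ j) t (x j) (y j)

open ProbabilityTheory

lemma tangent_le_of_deriv2_nonneg {ψ : ℝ → ℝ} (hψ : Differentiable ℝ ψ)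
    (hψ' : Differentiable ℝ (deriv ψ)) (h2 : ∀ s, 0 ≤ deriv (deriv ψ) s) (x y : ℝ) :
    ψ x + deriv ψ x * (y - x) ≤ ψ y := by
  have hc : ConvexOn ℝ Set.univ ψ := convexOn_univ_of_deriv2_nonneg hψ hψ' h2
  rcases lt_trichotomy x y with h | rfl | h
  · have := hc.deriv_le_slope (Set.mem_univ x) (Set.mem_univ y) h (hψ x)
    rw [slope_def_field, le_div_iff₀ (by linarith)] at this
    linarith
  · simp
  · have := hc.slope_le_deriv (Set.mem_univ y) (Set.mem_univ x) h (hψ x)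
    rw [slope_def_field, div_le_iff₀ (by linarith)] at this
    linarith

/-- The one-dimensional Li–Yau bound for a quadratic perturbation of a convex function. -/
lemma neg_dunkl_quadratic_add_convex_le {ψ : ℝ → ℝ} (hψ : Differentiable ℝ ψ)
    (hψ' : Differentiable ℝ (deriv ψ)) (h2 : ∀ s, 0 ≤ deriv (deriv ψ) s) {κ x : ℝ}
    (hκ : 0 ≤ κ) (hx : x ≠ 0) (A c : ℝ) {G : ℝ → ℝ}
    (hG : ∀ s, G s = A - c / 2 * s ^ 2 + ψ s) :
    -(deriv (deriv G) x + κ / x ^ 2 * (2 * x * deriv G x - G x + G (-x)))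
      ≤ (1 + 2 * κ) * c := by
  have h1 : ∀ s, HasDerivAt G (-c * s + deriv ψ s) s := by
    intro s
    rw [funext hG]
    refine ((((hasDerivAt_pow 2 s).const_mul (c / 2)).const_sub A).add
      (hψ s).hasDerivAt).congr_deriv ?_
    norm_num
    ring
  have hG1 : deriv G = fun s => -c * s + deriv ψ s := funext fun s => (h1 s).deriv
  have hG2 : deriv (deriv G) x = -c + deriv (deriv ψ) x := by
    rw [hG1]
    refine (((hasDerivAt_id' x).const_mul (-c)).add (hψ' x).hasDerivAt).deriv.trans ?_
    ring
  have ht := tangent_le_of_deriv2_nonneg hψ hψ' h2 x (-x)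
  have key : 2 * x * deriv G x - G x + G (-x)
      = -2 * c * x ^ 2 + (2 * x * deriv ψ x - ψ x + ψ (-x)) := by
    rw [hG1, hG, hG]
    ring
  have hpos : 0 ≤ κ / x ^ 2 * (2 * x * deriv ψ x - ψ x + ψ (-x)) :=
    mul_nonneg (by positivity) (by linarith)
  have hcancel : κ / x ^ 2 * (-2 * c * x ^ 2) = -2 * c * κ := by
    field_simp
  rw [hG2, key, mul_add, hcancel]
  linarith [h2 x]

/-- The weight `(1 - s)^(κ - 1) (1 + s)^κ` on `(-1, 1]` as a measure. -/
noncomputable def dunklWeight (κ : ℝ) : Measure ℝ :=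
  (volume.restrict (Set.Ioc (-1 : ℝ) 1)).withDensity
    fun s => ENNReal.ofReal ((1 - s) ^ (κ - 1) * (1 + s) ^ κ)

lemma intervalIntegrable_dunklWeight {κ : ℝ} (hκ : 0 < κ) :
    IntervalIntegrable (fun s : ℝ => (1 - s) ^ (κ - 1) * (1 + s) ^ κ) volume (-1) 1 := by
  have h : IntervalIntegrable (fun s : ℝ => s ^ (κ - 1)) volume 2 0 :=
    intervalIntegral.intervalIntegrable_rpow' (by linarith)
  have h' := h.comp_sub_left 1
  norm_num at h'
  refine h'.mul_continuousOn (Continuous.continuousOn ?_)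
  exact (continuous_const.add continuous_id).rpow_const fun _ => Or.inr hκ.le

lemma isFiniteMeasure_dunklWeight {κ : ℝ} (hκ : 0 < κ) : IsFiniteMeasure (dunklWeight κ) :=
  isFiniteMeasure_withDensity_ofReal
    ((intervalIntegrable_iff_integrableOn_Ioc_of_le (by norm_num)).1
      (intervalIntegrable_dunklWeight hκ)).2

lemma ae_mem_dunklWeight (κ : ℝ) : ∀ᵐ s ∂dunklWeight κ, s ∈ Set.Ioc (-1 : ℝ) 1 :=
  (withDensity_absolutelyContinuous _ _).ae_le (ae_restrict_mem measurableSet_Ioc)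

lemma dunklWeight_ne_zero (κ : ℝ) : dunklWeight κ ≠ 0 := by
  intro h
  have hm : Measurable fun s : ℝ => ENNReal.ofReal ((1 - s) ^ (κ - 1) * (1 + s) ^ κ) := by
    fun_prop
  rw [dunklWeight, withDensity_eq_zero_iff hm.aemeasurable] at h
  have h' : ∀ᵐ s ∂(volume.restrict (Set.Ioo (-1 : ℝ) 1)), False := by
    have hle : volume.restrict (Set.Ioo (-1 : ℝ) 1) ≤ volume.restrict (Set.Ioc (-1 : ℝ) 1) :=
      Measure.restrict_mono Set.Ioo_subset_Ioc_self le_rfl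
    filter_upwards [ae_mono hle h, ae_restrict_mem measurableSet_Ioo] with s hs hs'
    have : 0 < (1 - s) ^ (κ - 1) * (1 + s) ^ κ :=
      mul_pos (rpow_pos_of_pos (by linarith [hs'.2]) _) (rpow_pos_of_pos (by linarith [hs'.1]) _)
    simp only [Pi.zero_apply, ENNReal.ofReal_eq_zero] at hs
    linarith
  rw [ae_iff] at h'
  norm_num at h'

lemma integral_dunklWeight (κ : ℝ) (g : ℝ → ℝ) :
    ∫ s, g s ∂dunklWeight κ
      = ∫ s in (-1 : ℝ)..1, (1 - s) ^ (κ - 1) * (1 + s) ^ κ * g s := by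
  rw [dunklWeight, integral_withDensity_eq_integral_toReal_smul (by fun_prop) (by simp),
    intervalIntegral.integral_of_le (by norm_num)]
  refine setIntegral_congr_fun measurableSet_Ioc fun s hs => ?_
  have : 0 ≤ (1 - s) ^ (κ - 1) * (1 + s) ^ κ :=
    mul_nonneg (rpow_nonneg (by linarith [hs.2]) _) (rpow_nonneg (by linarith [hs.1]) _)
  simp [ENNReal.toReal_ofReal this]

lemma integrable_exp_mul_dunklWeight {κ : ℝ} (hκ : 0 < κ) (b u : ℝ) :
    Integrable (fun s => exp (u * (b * s))) (dunklWeight κ) := by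
  have := isFiniteMeasure_dunklWeight hκ
  have h := integrable_exp_mul_of_mem_Icc (μ := dunklWeight κ) (X := id) (t := u * b)
    aemeasurable_id ((ae_mem_dunklWeight κ).mono fun s hs => Set.Ioc_subset_Icc_self hs)
  simpa [mul_assoc] using h

lemma mem_interior_integrableExpSet_dunklWeight {κ : ℝ} (hκ : 0 < κ) (b u : ℝ) :
    u ∈ interior (integrableExpSet (fun s => b * s) (dunklWeight κ)) := by
  simp [integrableExpSet, integrable_exp_mul_dunklWeight hκ b]

lemma analyticOnNhd_cgf_dunklWeight {κ : ℝ} (hκ : 0 < κ) (b : ℝ) :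
    AnalyticOnNhd ℝ (cgf (fun s => b * s) (dunklWeight κ)) Set.univ :=
  fun u _ => analyticAt_cgf (mem_interior_integrableExpSet_dunklWeight hκ b u)

lemma deriv2_cgf_dunklWeight_nonneg {κ : ℝ} (hκ : 0 < κ) (b u : ℝ) :
    0 ≤ deriv (deriv (cgf (fun s => b * s) (dunklWeight κ))) u := by
  have h := iteratedDeriv_two_cgf_eq_integral
    (mem_interior_integrableExpSet_dunklWeight hκ b u)
  rw [iteratedDeriv_succ, iteratedDeriv_one] at h
  rw [h]
  exact div_nonneg (integral_nonneg fun s => by positivity) mgf_nonneg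

lemma hKer_eq_mgf (κ t u v : ℝ) :
    hKer κ t u v = ((2 : ℝ) ^ (κ + 1/2) * Real.sqrt π * Real.Gamma (κ + 1/2))⁻¹
      * Real.sinh (2*t) ^ (-(κ + 1/2))
      * Real.exp (-(1/2) * (Real.cosh (2*t) / Real.sinh (2*t)) * (u^2 + v^2))
      * mgf (fun s => v / Real.sinh (2*t) * s) (dunklWeight κ) u := by
  rw [hKer, mgf, integral_dunklWeight]
  congr! 5 with s
  ring_nf

lemma hKer_pos {κ t : ℝ} (hκ : 0 < κ) (ht : 0 < t) (u v : ℝ) : 0 < hKer κ t u v := by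
  have hm : 0 < mgf (fun s => v / Real.sinh (2*t) * s) (dunklWeight κ) u :=
    mgf_pos' (dunklWeight_ne_zero κ) (integrable_exp_mul_dunklWeight hκ _ u)
  have hs : 0 < Real.sinh (2*t) := Real.sinh_pos_iff.2 (by linarith)
  have hΓ : 0 < Real.Gamma (κ + 1/2) := Real.Gamma_pos_of_pos (by linarith)
  rw [hKer_eq_mgf]
  have := Real.pi_pos
  positivity

lemma exists_log_hKer_eq {κ t : ℝ} (hκ : 0 < κ) (ht : 0 < t) (v : ℝ) :
    ∃ A, ∀ u, Real.log (hKer κ t u v)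
      = A - (Real.cosh (2*t) / Real.sinh (2*t)) / 2 * u ^ 2
        + cgf (fun s => v / Real.sinh (2*t) * s) (dunklWeight κ) u := by
  have hs : 0 < Real.sinh (2*t) := Real.sinh_pos_iff.2 (by linarith)
  have hΓ : 0 < Real.Gamma (κ + 1/2) := Real.Gamma_pos_of_pos (by linarith)
  have hC : 0 < ((2 : ℝ) ^ (κ + 1/2) * Real.sqrt π * Real.Gamma (κ + 1/2))⁻¹
      * Real.sinh (2*t) ^ (-(κ + 1/2)) := by
    have := Real.pi_pos
    positivity
  refine ⟨Real.log (((2 : ℝ) ^ (κ + 1/2) * Real.sqrt π * Real.Gamma (κ + 1/2))⁻¹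
    * Real.sinh (2*t) ^ (-(κ + 1/2))) - (Real.cosh (2*t) / Real.sinh (2*t)) / 2 * v ^ 2,
    fun u => ?_⟩
  have hm : 0 < mgf (fun s => v / Real.sinh (2*t) * s) (dunklWeight κ) u :=
    mgf_pos' (dunklWeight_ne_zero κ) (integrable_exp_mul_dunklWeight hκ _ u)
  rw [hKer_eq_mgf, Real.log_mul (by positivity) hm.ne',
    Real.log_mul hC.ne' (Real.exp_ne_zero _), Real.log_exp, cgf]
  ring

lemma neg_dunkl_log_hKer_le {κ t x : ℝ} (hκ : 0 < κ) (ht : 0 < t) (hx : x ≠ 0) (v B : ℝ)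
    {G : ℝ → ℝ} (hG : ∀ s, G s = B + Real.log (hKer κ t s v)) :
    -(deriv (deriv G) x + κ / x ^ 2 * (2 * x * deriv G x - G x + G (-x)))
      ≤ (1 + 2 * κ) * (Real.cosh (2*t) / Real.sinh (2*t)) := by
  obtain ⟨A, hA⟩ := exists_log_hKer_eq hκ ht v
  have han := analyticOnNhd_cgf_dunklWeight hκ (v / Real.sinh (2*t))
  refine neg_dunkl_quadratic_add_convex_le
    (fun s => (han s trivial).differentiableAt) (fun s => (han.deriv s trivial).differentiableAt)
    (deriv2_cgf_dunklWeight_nonneg hκ _) hκ.le hx (B + A) _ fun s => ?_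
  rw [hG, hA]
  ring

lemma pd_update {d : ℕ} (f : (Fin d → ℝ) → ℝ) (j : Fin d) (x : Fin d → ℝ) (s : ℝ) :
    pd f j (Function.update x j s) = deriv (fun r => f (Function.update x j r)) s := by
  simp [pd]

lemma log_hHeat_update {d : ℕ} {κ : Fin d → ℝ} (hκ : ∀ j, 0 < κ j) {t : ℝ} (ht : 0 < t)
    (x y : Fin d → ℝ) (j : Fin d) (s : ℝ) :
    Real.log (hHeat κ t (Function.update x j s) y)
      = ∑ i ∈ Finset.univ.erase j, Real.log (hKer (κ i) t (x i) (y i))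
        + Real.log (hKer (κ j) t s (y j)) := by
  rw [hHeat, Real.log_prod fun i _ => (hKer_pos (hκ i) ht _ _).ne',
    ← Finset.sum_erase_add _ _ (Finset.mem_univ j), Function.update_self]
  congr 1
  refine Finset.sum_congr rfl fun i hi => ?_
  rw [Function.update_of_ne (Finset.ne_of_mem_erase hi)]

lemma cosh_div_sinh_le {s : ℝ} (hs : 0 < s) : Real.cosh s / Real.sinh s ≤ 1 + 1 / s := by
  have hsinh : 0 < Real.sinh s := Real.sinh_pos_iff.2 hs
  have h : s ≤ Real.sinh s := Real.self_le_sinh_iff.2 hs.le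
  have he : s * Real.exp (-s) ≤ s :=
    mul_le_of_le_one_right hs.le (Real.exp_le_one_iff.2 (by linarith))
  rw [← Real.cosh_sub_sinh] at he
  rw [div_le_iff₀ hsinh, one_add_mul, ← sub_le_iff_le_add', one_div, inv_mul_eq_div,
    le_div_iff₀ hs]
  linarith

/-- **Sharp Li–Yau inequality for the heat kernel of the Dunkl harmonic oscillator**
(`ℤ₂^d` case): for `t > 0`, `y ∈ ℝ^d` and `x` with all coordinates nonzero,
`−Δ_κ(log h_t(·,y))(x) ≤ (d + 2λ_κ) coth(2t) ≤ (d + 2λ_κ)(1 + 1/(2t))`. -/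
theorem stmt0 (d : ℕ) (hd : 1 ≤ d) (κ : Fin d → ℝ) (hκ : ∀ j, 0 < κ j)
    (lamκ : ℝ) (hlam : lamκ = ∑ j, κ j)
    (t : ℝ) (ht : 0 < t) (y : Fin d → ℝ) (x : Fin d → ℝ) (hx : ∀ j, x j ≠ 0) :
    -dunklLapZ2 κ (fun z => Real.log (hHeat κ t z y)) x
        ≤ ((d : ℝ) + 2 * lamκ) * (Real.cosh (2*t) / Real.sinh (2*t))
    ∧ ((d : ℝ) + 2 * lamκ) * (Real.cosh (2*t) / Real.sinh (2*t))
        ≤ ((d : ℝ) + 2 * lamκ) * (1 + 1/(2*t)) := by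
  have hlam0 : 0 ≤ lamκ := hlam ▸ Finset.sum_nonneg fun j _ => (hκ j).le
  refine ⟨?_, mul_le_mul_of_nonneg_left (cosh_div_sinh_le (by linarith)) (by positivity)⟩
  have hsum : ((d : ℝ) + 2 * lamκ) * (Real.cosh (2*t) / Real.sinh (2*t))
      = ∑ j, (1 + 2 * κ j) * (Real.cosh (2*t) / Real.sinh (2*t)) := by
    rw [← Finset.sum_mul, Finset.sum_add_distrib, ← Finset.mul_sum, hlam]
    simp
  rw [hsum, dunklLapZ2, ← Finset.sum_neg_distrib]
  refine Finset.sum_le_sum fun j _ => ?_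
  have h := neg_dunkl_log_hKer_le (hκ j) ht (hx j) (y j) _ (log_hHeat_update hκ ht x y j)
  have hd2 : pd (fun z => pd (fun z => Real.log (hHeat κ t z y)) j z) j x
      = deriv (deriv fun s => Real.log (hHeat κ t (Function.update x j s) y)) (x j) := by
    rw [pd]
    simp only [pd_update]
  rw [hd2]
  simpa only [pd, Function.update_eq_self] using h
end

section
/- Let h_t(x,y) = (2π sinh(2t))^{−d} exp(−(1/4)[tanh(t)|x+y|² + coth(t)|x−y|²]) for t > 0 and x,y ∈ ℝ^d, the heat kernel of the classic harmonic oscillator L = Δ − |x|² on ℝ^d. Then for every t > 0 and every x,y ∈ ℝ^d, −Δ_x(log h_t(·,y))(x) = d coth(2t), where Δ is the standard Laplacian acting in the x-variable; in particular d coth(2t) ≤ d(1 + 1/(2t)). This shows the Li–Yau bound (d+2λ_κ)coth(2t) is attained when κ = 0. -/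
open Real

/-- The standard Laplacian `Δ f(x) = Σ_j ∂²f/∂x_j²(x)` on `ℝ^d`. -/
noncomputable def stdLap {d : ℕ} (f : (Fin d → ℝ) → ℝ) (x : Fin d → ℝ) : ℝ :=
  ∑ j, pd (fun z => pd f j z) j x

/-- The heat kernel of the classic harmonic oscillator `L = Δ − |x|²` on `ℝ^d`:
`h_t(x,y) = (2π sinh(2t))^{−d} exp(−(1/4)[tanh(t)|x+y|² + coth(t)|x−y|²])`. -/
noncomputable def hOsc (d : ℕ) (t : ℝ) (x y : Fin d → ℝ) : ℝ :=
  ((2 * π * Real.sinh (2*t)) ^ d)⁻¹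
    * Real.exp (-(1/4) * (Real.tanh t * (∑ j, (x j + y j)^2)
        + (Real.cosh t / Real.sinh t) * (∑ j, (x j - y j)^2)))

theorem pd_const_add_sum {d : ℕ} (c : ℝ) (g g' : Fin d → ℝ → ℝ) (j : Fin d) (x : Fin d → ℝ)
    (hg : HasDerivAt (g j) (g' j (x j)) (x j)) :
    pd (fun z => c + ∑ i, g i (z i)) j x = g' j (x j) := by
  have key : (fun s => c + ∑ i, g i (Function.update x j s i))
      = fun s => g j s + (c + ∑ i ∈ Finset.univ.erase j, g i (x i)) := by
    funext s
    rw [← Finset.add_sum_erase _ _ (Finset.mem_univ j), Function.update_self,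
      Finset.sum_congr rfl fun i hi => by rw [Function.update_of_ne (Finset.ne_of_mem_erase hi)]]
    ring
  rw [pd, key]
  exact (hg.add_const _).deriv

theorem stdLap_const_add_sum {d : ℕ} (c : ℝ) (g g' g'' : Fin d → ℝ → ℝ)
    (hg : ∀ j s, HasDerivAt (g j) (g' j s) s) (hg' : ∀ j s, HasDerivAt (g' j) (g'' j s) s)
    (x : Fin d → ℝ) :
    stdLap (fun z => c + ∑ i, g i (z i)) x = ∑ j, g'' j (x j) := by
  refine Finset.sum_congr rfl fun j _ => ?_
  have h : (fun z => pd (fun z => c + ∑ i, g i (z i)) j z) = fun z : Fin d → ℝ => g' j (z j) :=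
    funext fun z => pd_const_add_sum c g g' j z (hg j _)
  rw [h, pd]
  simp only [Function.update_self]
  exact (hg' j (x j)).deriv

theorem log_hOsc (d : ℕ) {t : ℝ} (ht : 0 < t) (x y : Fin d → ℝ) :
    Real.log (hOsc d t x y) = Real.log (((2 * π * Real.sinh (2*t)) ^ d)⁻¹)
      + ∑ j, -(1/4) * (Real.tanh t * (x j + y j)^2
        + (Real.cosh t / Real.sinh t) * (x j - y j)^2) := by
  have hs : 0 < Real.sinh (2*t) := Real.sinh_pos_iff.2 (by positivity)
  rw [hOsc, Real.log_mul (by positivity) (Real.exp_ne_zero _), Real.log_exp,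
    ← Finset.mul_sum, Finset.sum_add_distrib, Finset.mul_sum, Finset.mul_sum]

theorem tanh_add_coth {t : ℝ} (ht : 0 < t) :
    Real.tanh t + Real.cosh t / Real.sinh t = 2 * (Real.cosh (2*t) / Real.sinh (2*t)) := by
  have hs : 0 < Real.sinh t := Real.sinh_pos_iff.2 ht
  have hc := Real.cosh_pos t
  rw [Real.tanh_eq_sinh_div_cosh, Real.cosh_two_mul, Real.sinh_two_mul]
  field_simp
  ring

theorem coth_le_one_add_inv {u : ℝ} (hu : 0 < u) :
    Real.cosh u / Real.sinh u ≤ 1 + 1 / u := by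
  have hs : 0 < Real.sinh u := Real.sinh_pos_iff.2 hu
  have h1 : u ≤ Real.sinh u := Real.self_le_sinh_iff.2 hu.le
  have h2 : Real.exp (-u) ≤ 1 := Real.exp_le_one_iff.2 (by linarith)
  have h3 := Real.cosh_sub_sinh u
  rw [div_le_iff₀ hs]
  have h4 : 1 ≤ 1 / u * Real.sinh u := by
    rw [one_div_mul_eq_div, le_div_iff₀ hu]
    linarith
  linarith

/-- For the heat kernel of the classic harmonic oscillator,
`−Δ_x(log h_t(·,y))(x) = d coth(2t)` for all `t > 0`, `x, y ∈ ℝ^d`;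
in particular `d coth(2t) ≤ d (1 + 1/(2t))`. -/
theorem stmt1 (d : ℕ) (t : ℝ) (ht : 0 < t) (x y : Fin d → ℝ) :
    -stdLap (fun z => Real.log (hOsc d t z y)) x
        = (d : ℝ) * (Real.cosh (2*t) / Real.sinh (2*t))
    ∧ (d : ℝ) * (Real.cosh (2*t) / Real.sinh (2*t)) ≤ (d : ℝ) * (1 + 1/(2*t)) := by
  refine ⟨?_, mul_le_mul_of_nonneg_left (coth_le_one_add_inv (by positivity)) (by positivity)⟩
  simp only [log_hOsc d ht]
  rw [stdLap_const_add_sum _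
    (fun j s => -(1/4) * (Real.tanh t * (s + y j)^2 + (Real.cosh t / Real.sinh t) * (s - y j)^2))
    (fun j s => -(1/2) * (Real.tanh t * (s + y j) + (Real.cosh t / Real.sinh t) * (s - y j)))
    (fun _ _ => -(1/2) * (Real.tanh t + Real.cosh t / Real.sinh t))]
  · rw [tanh_add_coth ht, Finset.sum_const, Finset.card_univ, Fintype.card_fin, nsmul_eq_mul]
    ring
  · intro j s
    have h1 := (((hasDerivAt_id' s).add_const (y j)).fun_pow 2).const_mul (Real.tanh t)
    have h2 := (((hasDerivAt_id' s).sub_const (y j)).fun_pow 2).const_mul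
      (Real.cosh t / Real.sinh t)
    refine ((h1.fun_add h2).const_mul (-(1/4))).congr_deriv ?_
    norm_num
    ring
  · intro j s
    have h1 := ((hasDerivAt_id' s).add_const (y j)).const_mul (Real.tanh t)
    have h2 := ((hasDerivAt_id' s).sub_const (y j)).const_mul (Real.cosh t / Real.sinh t)
    refine ((h1.fun_add h2).const_mul (-(1/2))).congr_deriv ?_
    ring
end

section
/- Let T ∈ (0,∞], V : (0,T) × ℝ^d → ℝ and β : (0,T) × ℝ^d → ℝ. Let h : (0,T) × ℝ^d × ℝ^d → (0,∞) be such that for each fixed y the map (t,x) ↦ h_t(x,y) is a C^{1,2} positive solution of ∂_t h_t(·,y)(x) = Δ_κ h_t(·,y)(x) − V(t,x) h_t(x,y) at every x with ⟨α,x⟩ ≠ 0 for all α ∈ R₊, and y ↦ h_t(x,y) is Borel measurable. Let u be a positive C^{1,2} function on [0,T) × ℝ^d with nonnegative measurable initial value u(0,·), satisfying u(t,x) = ∫_{ℝ^d} u(0,y) h_t(x,y) dμ_κ(y) and ∂_t u(t,x) = ∫_{ℝ^d} u(0,y) ∂_t h_t(x,y) dμ_κ(y) for all (t,x) ∈ (0,T)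 × ℝ^d, and assume that the gradient in x and each term of Δ_κ in x may be taken under the integral sign (all the corresponding integrals being absolutely convergent). If −Δ_κ(log h_t(·,y))(x) ≤ β(t,x) for all t ∈ (0,T), all y ∈ ℝ^d and all x with ⟨α,x⟩ ≠ 0 for every α ∈ R₊, then −Δ_κ(log u(t,·))(x) ≤ β(t,x) for all such (t,x). -/
open Real MeasureTheory

/-- The reflection `σ_α x = x − ⟨α,x⟩ α` in the hyperplane `α^⊥` (for `|α|² = 2`). -/
def reflAlpha {d : ℕ} (α x : Fin d → ℝ) : Fin d → ℝ :=
  fun i => x i - (∑ k, α k * x k) * α i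

/-- The Dunkl Laplacian associated with the subsystem `R₊` and multiplicity `κ`:
`Δ_κ f(x) = Δf(x) + 2 Σ_{α∈R₊} κ_α [⟨α,∇f(x)⟩/⟨α,x⟩ − (f(x) − f(σ_α x))/⟨α,x⟩²]`. -/
noncomputable def dunklLapG {d : ℕ} (Rp : Finset (Fin d → ℝ)) (κ : (Fin d → ℝ) → ℝ)
    (f : (Fin d → ℝ) → ℝ) (x : Fin d → ℝ) : ℝ :=
  stdLap f x + 2 * ∑ α ∈ Rp, κ α *
    ((∑ i, α i * pd f i x) / (∑ i, α i * x i)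
      - (f x - f (reflAlpha α x)) / (∑ i, α i * x i) ^ 2)

/-- The weighted measure `μ_κ(dx) = ∏_{α∈R₊} |⟨α,x⟩|^{κ_α} dx` on `ℝ^d`. -/
noncomputable def dunklMeasure {d : ℕ} (Rp : Finset (Fin d → ℝ)) (κ : (Fin d → ℝ) → ℝ) :
    Measure (Fin d → ℝ) :=
  volume.withDensity (fun x => ENNReal.ofReal (∏ α ∈ Rp, |∑ i, α i * x i| ^ κ α))

section PartialDerivatives

variable {d : ℕ} {f : (Fin d → ℝ) → ℝ} {x : Fin d → ℝ} {j : Fin d}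

theorem hasDerivAt_pd (hf : DifferentiableAt ℝ f x) :
    HasDerivAt (fun s => f (Function.update x j s)) (pd f j x) (x j) := by
  refine DifferentiableAt.hasDerivAt ?_
  have hupd : DifferentiableAt ℝ (Function.update x j) (x j) :=
    (hasDerivAt_update x j (x j)).differentiableAt
  refine DifferentiableAt.comp (x j) ?_ hupd
  rwa [Function.update_eq_self]

theorem pd_eq_fderiv (hf : DifferentiableAt ℝ f x) :
    pd f j x = fderiv ℝ f x (Pi.single j 1) := by
  have hf' : HasFDerivAt f (fderiv ℝ f x) (Function.update x j (x j)) := by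
    rw [Function.update_eq_self]
    exact hf.hasFDerivAt
  exact (hf'.comp_hasDerivAt (x j) (hasDerivAt_update x j (x j))).deriv

theorem differentiable_pd (hf : ContDiff ℝ 2 f) : Differentiable ℝ (pd f j) := by
  have h1 : pd f j = fun z => fderiv ℝ f z (Pi.single j 1) :=
    funext fun z => pd_eq_fderiv (hf.differentiable (by norm_num) z)
  rw [h1]
  exact ((hf.fderiv_right (m := 1) (by norm_num)).differentiable (by norm_num)).clm_apply
    (differentiable_const _)

theorem pd_log (hf : DifferentiableAt ℝ f x) (h0 : f x ≠ 0) :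
    pd (fun z => Real.log (f z)) j x = pd f j x / f x := by
  have h1 := (hasDerivAt_pd (j := j) hf).log (by rwa [Function.update_eq_self])
  rw [Function.update_eq_self] at h1
  exact h1.deriv

theorem pd_pd_log (hf : ContDiff ℝ 2 f) (h0 : ∀ z, f z ≠ 0) :
    pd (fun z => pd (fun w => Real.log (f w)) j z) j x
      = (pd (fun z => pd f j z) j x * f x - pd f j x * pd f j x) / f x ^ 2 := by
  have hd : Differentiable ℝ f := hf.differentiable (by norm_num)
  have h1 : (fun z => pd (fun w => Real.log (f w)) j z) = fun z => pd f j z / f z :=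
    funext fun z => pd_log (hd z) (h0 z)
  rw [h1]
  have h2 := (hasDerivAt_pd (j := j) (differentiable_pd (j := j) hf x)).div
    (hasDerivAt_pd (j := j) (hd x)) (h0 _)
  rw [Function.update_eq_self] at h2
  exact h2.deriv

end PartialDerivatives

/-- The linear functional in `f` whose infimum over the slopes `q` and ratios `r` is
`f x * Δ_κ (log f) x`. -/
noncomputable def dunklLogTangent {d : ℕ} (Rp : Finset (Fin d → ℝ)) (κ : (Fin d → ℝ) → ℝ)
    (q : Fin d → ℝ) (r : (Fin d → ℝ) → ℝ) (f : (Fin d → ℝ) → ℝ) (x : Fin d → ℝ) : ℝ :=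
  ∑ j, (pd (fun z => pd f j z) j x + -2 * q j * pd f j x + q j ^ 2 * f x)
    + 2 * ∑ α ∈ Rp, κ α *
      ((∑ i, α i * x i)⁻¹ * (∑ i, α i * pd f i x)
        + ((∑ i, α i * x i) ^ 2)⁻¹ *
          ((Real.log (r α) - 1) * f x + (r α)⁻¹ * f (reflAlpha α x)))

section Tangent

variable {d : ℕ} {Rp : Finset (Fin d → ℝ)} {κ : (Fin d → ℝ) → ℝ} {f : (Fin d → ℝ) → ℝ}

theorem mul_dunklLapG_log (hf : ContDiff ℝ 2 f) (hpos : ∀ z, 0 < f z) (x : Fin d → ℝ) :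
    f x * dunklLapG Rp κ (fun z => Real.log (f z)) x
      = ∑ j, (pd (fun z => pd f j z) j x - pd f j x ^ 2 / f x)
        + 2 * ∑ α ∈ Rp, κ α *
          ((∑ i, α i * x i)⁻¹ * (∑ i, α i * pd f i x)
            + ((∑ i, α i * x i) ^ 2)⁻¹ *
              (f x * (Real.log (f (reflAlpha α x)) - Real.log (f x)))) := by
  have hne := (hpos x).ne'
  have hd : Differentiable ℝ f := hf.differentiable (by norm_num)
  have hlog : ∀ j, pd (fun z => Real.log (f z)) j x = pd f j x / f x :=
    fun j => pd_log (hd x) hne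
  simp only [dunklLapG, stdLap, pd_pd_log hf (fun z => (hpos z).ne'), hlog]
  rw [mul_add, mul_left_comm, Finset.mul_sum, Finset.mul_sum]
  congr 1
  · refine Finset.sum_congr rfl fun j _ => ?_
    field_simp
  · congr 1
    refine Finset.sum_congr rfl fun α _ => ?_
    have h1 : ∑ i, α i * (pd f i x / f x) = (∑ i, α i * pd f i x) / f x := by
      rw [Finset.sum_div]
      exact Finset.sum_congr rfl fun i _ => by ring
    rw [h1]
    simp only [div_eq_mul_inv]
    linear_combination (κ α * (∑ i, α i * pd f i x) * (∑ i, α i * x i)⁻¹)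
      * mul_inv_cancel₀ hne

theorem mul_dunklLapG_log_le_dunklLogTangent (hκ : ∀ α ∈ Rp, 0 ≤ κ α) (hf : ContDiff ℝ 2 f)
    (hpos : ∀ z, 0 < f z) (q : Fin d → ℝ) {r : (Fin d → ℝ) → ℝ} (hr : ∀ α, 0 < r α)
    (x : Fin d → ℝ) :
    f x * dunklLapG Rp κ (fun z => Real.log (f z)) x ≤ dunklLogTangent Rp κ q r f x := by
  have hfx := hpos x
  rw [mul_dunklLapG_log hf hpos, dunklLogTangent]
  refine add_le_add (Finset.sum_le_sum fun j _ => ?_) (mul_le_mul_of_nonneg_left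
    (Finset.sum_le_sum fun α hα => mul_le_mul_of_nonneg_left (add_le_add le_rfl
      (mul_le_mul_of_nonneg_left ?_ (by positivity))) (hκ α hα)) zero_le_two)
  · have h1 : 0 ≤ (pd f j x - q j * f x) ^ 2 / f x := by positivity
    have h2 : (pd f j x - q j * f x) ^ 2 / f x
        = pd f j x ^ 2 / f x + -2 * q j * pd f j x + q j ^ 2 * f x := by
      field_simp
      ring
    linarith
  · have hg := hpos (reflAlpha α x)
    have hrα := hr α
    have h1 := Real.log_le_sub_one_of_pos (div_pos hg (mul_pos hfx hrα))
    rw [Real.log_div hg.ne' (mul_pos hfx hrα).ne', Real.log_mul hfx.ne' hrα.ne'] at h1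
    have h2 := mul_le_mul_of_nonneg_left h1 hfx.le
    have h3 : f x * (f (reflAlpha α x) / (f x * r α) - 1)
        = (r α)⁻¹ * f (reflAlpha α x) - f x := by
      field_simp
    linarith

theorem mul_dunklLapG_log_eq_dunklLogTangent (hf : ContDiff ℝ 2 f) (hpos : ∀ z, 0 < f z)
    (x : Fin d → ℝ) :
    f x * dunklLapG Rp κ (fun z => Real.log (f z)) x
      = dunklLogTangent Rp κ (fun j => pd f j x / f x)
          (fun α => f (reflAlpha α x) / f x) f x := by
  have hne := (hpos x).ne'
  rw [mul_dunklLapG_log hf hpos, dunklLogTangent]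
  congr 1
  · refine Finset.sum_congr rfl fun j _ => ?_
    field_simp
    ring
  · congr 1
    refine Finset.sum_congr rfl fun α _ => ?_
    have hg := (hpos (reflAlpha α x)).ne'
    rw [Real.log_div hg hne]
    congr 3
    field_simp
    ring

end Tangent

/-- `F` is integrable with integral `v`. -/
def HasBochnerIntegral {X : Type*} [MeasurableSpace X] (μ : Measure X) (F : X → ℝ) (v : ℝ) : Prop :=
  Integrable F μ ∧ v = ∫ y, F y ∂μ

namespace HasBochnerIntegral

variable {X : Type*} [MeasurableSpace X] {μ : Measure X} {w F G : X → ℝ} {a b : ℝ}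

theorem add (hF : HasBochnerIntegral μ (fun y => w y * F y) a)
    (hG : HasBochnerIntegral μ (fun y => w y * G y) b) :
    HasBochnerIntegral μ (fun y => w y * (F y + G y)) (a + b) := by
  simp only [mul_add]
  exact ⟨hF.1.add hG.1, by rw [integral_add hF.1 hG.1, hF.2, hG.2]⟩

theorem const_mul (c : ℝ) (hF : HasBochnerIntegral μ (fun y => w y * F y) a) :
    HasBochnerIntegral μ (fun y => w y * (c * F y)) (c * a) := by
  simp only [mul_left_comm _ c]
  exact ⟨hF.1.const_mul c, by rw [integral_const_mul, hF.2]⟩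

theorem sum {ι : Type*} {s : Finset ι} {F : ι → X → ℝ} {a : ι → ℝ}
    (hF : ∀ i ∈ s, HasBochnerIntegral μ (fun y => w y * F i y) (a i)) :
    HasBochnerIntegral μ (fun y => w y * ∑ i ∈ s, F i y) (∑ i ∈ s, a i) := by
  simp only [Finset.mul_sum]
  refine ⟨integrable_finsetSum s fun i hi => (hF i hi).1, ?_⟩
  rw [integral_finsetSum s fun i hi => (hF i hi).1]
  exact Finset.sum_congr rfl fun i hi => (hF i hi).2

theorem nonneg (hF : HasBochnerIntegral μ F a) (h0 : ∀ y, 0 ≤ F y) : 0 ≤ a :=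
  hF.2 ▸ integral_nonneg h0

end HasBochnerIntegral

theorem hasBochnerIntegral_dunklLogTangent {d : ℕ} {X : Type*} [MeasurableSpace X] {μ : Measure X}
    {w : X → ℝ} {f : (Fin d → ℝ) → ℝ} {k : X → (Fin d → ℝ) → ℝ} {x : Fin d → ℝ}
    (Rp : Finset (Fin d → ℝ)) (κ : (Fin d → ℝ) → ℝ) (q : Fin d → ℝ) (r : (Fin d → ℝ) → ℝ)
    (hval : ∀ z, HasBochnerIntegral μ (fun y => w y * k y z) (f z))
    (hgrad : ∀ j, HasBochnerIntegral μ (fun y => w y * pd (k y) j x) (pd f j x))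
    (hlap : ∀ j, HasBochnerIntegral μ (fun y => w y * pd (fun z => pd (k y) j z) j x)
      (pd (fun z => pd f j z) j x)) :
    HasBochnerIntegral μ (fun y => w y * dunklLogTangent Rp κ q r (k y) x)
      (dunklLogTangent Rp κ q r f x) := by
  unfold dunklLogTangent
  refine .add (.sum fun j _ => .add (.add (hlap j) (.const_mul _ (hgrad j)))
    (.const_mul _ (hval x))) (.const_mul _ (.sum fun α _ => .const_mul _ (.add
      (.const_mul _ (.sum fun i _ => .const_mul _ (hgrad i))) (.const_mul _ (.add
        (.const_mul _ (hval x)) (.const_mul _ (hval _)))))))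

/-- **Transference of the Li–Yau inequality from the heat kernel to general positive
solutions** of the non-local Schrödinger equation `∂_t u = Δ_κ u − V u`.  If the kernel
`h` satisfies `−Δ_κ(log h_t(·,y))(x) ≤ β(t,x)` and `u` is a positive `C^{1,2}` solution
represented by `h` (with differentiation under the integral sign allowed), then also
`−Δ_κ(log u(t,·))(x) ≤ β(t,x)`. -/
theorem stmt2 (d : ℕ) (Rp : Finset (Fin d → ℝ))
    (hRp : ∀ α ∈ Rp, ∑ i, (α i) ^ 2 = 2)
    (κ : (Fin d → ℝ) → ℝ) (hκ : ∀ α ∈ Rp, 0 ≤ κ α)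
    (T : EReal) (hT : 0 < T)
    (V β : ℝ → (Fin d → ℝ) → ℝ)
    (h : ℝ → (Fin d → ℝ) → (Fin d → ℝ) → ℝ)
    -- positivity of the kernel
    (hhpos : ∀ (t : ℝ) x y, 0 < t → (t : EReal) < T → 0 < h t x y)
    -- the kernel is `C^{1,2}`
    (hhC1 : ∀ x y, ContDiffOn ℝ 1 (fun s => h s x y) {s : ℝ | 0 < s ∧ (s : EReal) < T})
    (hhC2 : ∀ (t : ℝ) y, 0 < t → (t : EReal) < T → ContDiff ℝ 2 (fun z => h t z y))
    -- the kernel solves `∂_t h = Δ_κ h − V h` at every regular point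
    (hhPDE : ∀ (t : ℝ) x y, 0 < t → (t : EReal) < T → (∀ α ∈ Rp, (∑ i, α i * x i) ≠ 0) →
      deriv (fun s => h s x y) t
        = dunklLapG Rp κ (fun z => h t z y) x - V t x * h t x y)
    -- Borel measurability in `y`
    (hhmeas : ∀ (t : ℝ) x, 0 < t → (t : EReal) < T → Measurable (fun y => h t x y))
    (u : ℝ → (Fin d → ℝ) → ℝ)
    -- `u` is positive on `[0,T) × ℝ^d` and `C^{1,2}`
    (hupos : ∀ (t : ℝ) x, 0 ≤ t → (t : EReal) < T → 0 < u t x)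
    (huC1 : ∀ x, ContDiffOn ℝ 1 (fun s => u s x) {s : ℝ | 0 < s ∧ (s : EReal) < T})
    (huC2 : ∀ (t : ℝ), 0 < t → (t : EReal) < T → ContDiff ℝ 2 (fun z => u t z))
    -- the initial value `u(0,·)` is nonnegative and measurable
    (hu0nonneg : ∀ y, 0 ≤ u 0 y) (hu0meas : Measurable (u 0))
    -- representation of `u` and `∂_t u` by the kernel, with absolute convergence
    (hrepint : ∀ (t : ℝ) x, 0 < t → (t : EReal) < T →
      Integrable (fun y => u 0 y * h t x y) (dunklMeasure Rp κ))
    (hrep : ∀ (t : ℝ) x, 0 < t → (t : EReal) < T →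
      u t x = ∫ y, u 0 y * h t x y ∂(dunklMeasure Rp κ))
    (hreptint : ∀ (t : ℝ) x, 0 < t → (t : EReal) < T →
      Integrable (fun y => u 0 y * deriv (fun s => h s x y) t) (dunklMeasure Rp κ))
    (hrept : ∀ (t : ℝ) x, 0 < t → (t : EReal) < T →
      deriv (fun s => u s x) t = ∫ y, u 0 y * deriv (fun s => h s x y) t ∂(dunklMeasure Rp κ))
    -- the gradient in `x` may be taken under the integral sign
    (hgradint : ∀ (t : ℝ) x (j : Fin d), 0 < t → (t : EReal) < T →
      Integrable (fun y => u 0 y * pd (fun z => h t z y) j x) (dunklMeasure Rp κ))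
    (hgrad : ∀ (t : ℝ) x (j : Fin d), 0 < t → (t : EReal) < T →
      pd (fun z => u t z) j x = ∫ y, u 0 y * pd (fun z => h t z y) j x ∂(dunklMeasure Rp κ))
    -- the second-order part of `Δ_κ` in `x` may be taken under the integral sign
    (hlapint : ∀ (t : ℝ) x (j : Fin d), 0 < t → (t : EReal) < T →
      Integrable (fun y => u 0 y * pd (fun z => pd (fun w => h t w y) j z) j x)
        (dunklMeasure Rp κ))
    (hlap : ∀ (t : ℝ) x (j : Fin d), 0 < t → (t : EReal) < T →
      pd (fun z => pd (fun w => u t w) j z) j x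
        = ∫ y, u 0 y * pd (fun z => pd (fun w => h t w y) j z) j x ∂(dunklMeasure Rp κ))
    -- Li–Yau inequality for the kernel
    (hLYker : ∀ (t : ℝ) x y, 0 < t → (t : EReal) < T → (∀ α ∈ Rp, (∑ i, α i * x i) ≠ 0) →
      -dunklLapG Rp κ (fun z => Real.log (h t z y)) x ≤ β t x) :
    -- conclusion: Li–Yau inequality for `u`
    ∀ (t : ℝ) x, 0 < t → (t : EReal) < T → (∀ α ∈ Rp, (∑ i, α i * x i) ≠ 0) →
      -dunklLapG Rp κ (fun z => Real.log (u t z)) x ≤ β t x := by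
  intro t x ht htT hx
  have hu : ∀ z, 0 < u t z := fun z => hupos t z ht.le htT
  have hval : ∀ z, HasBochnerIntegral (dunklMeasure Rp κ) (fun y => u 0 y * h t z y) (u t z) :=
    fun z => ⟨hrepint t z ht htT, hrep t z ht htT⟩
  have htangent := hasBochnerIntegral_dunklLogTangent (k := fun y z => h t z y) Rp κ
    (fun j => pd (u t) j x / u t x) (fun α => u t (reflAlpha α x) / u t x) hval
    (fun j => ⟨hgradint t x j ht htT, hgrad t x j ht htT⟩)
    (fun j => ⟨hlapint t x j ht htT, hlap t x j ht htT⟩)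
  have hnonneg := (htangent.add ((hval x).const_mul (β t x))).nonneg fun y => by
    refine mul_nonneg (hu0nonneg y) ?_
    have h1 := mul_dunklLapG_log_le_dunklLogTangent hκ (hhC2 t y ht htT)
      (fun z => hhpos t z y ht htT) (fun j => pd (u t) j x / u t x)
      (r := fun α => u t (reflAlpha α x) / u t x) (fun α => div_pos (hu _) (hu x)) x
    have h2 := mul_le_mul_of_nonneg_left (hLYker t x y ht htT hx) (hhpos t x y ht htT).le
    linarith
  rw [← mul_dunklLapG_log_eq_dunklLogTangent (huC2 t ht htT) hu] at hnonneg
  refine le_of_mul_le_mul_left ?_ (hu x)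
  linarith
end

section
/- Let d ≥ 1, λ ≥ 0, T ∈ (0,∞], and let u : (0,T) × ℝ^d → (0,∞) be C¹ in t and C¹ in x, satisfying the Li–Yau gradient estimate |∇u(t,·)(x)|²/u(t,x)² − ∂_t u(t,x)/u(t,x) ≤ (d + 2λ) coth(2t) + |x|² for all (t,x) ∈ (0,T) × ℝ^d. Then for every 0 < s < t < T and every x,y ∈ ℝ^d, u(s,x) ≤ u(t,y) (sinh(2t)/sinh(2s))^{(d+2λ)/2} exp( |x−y|²/(4(t−s)) + (t−s) ς(x,y) ) ≤ u(t,y) (t/s)^{(d+2λ)/2} exp( |x−y|²/(4(t−s)) + (t−s)[d + 2λ + ς(x,y)] ), where ς(x,y) = (|x|² + |y|² + ⟨x,y⟩)/3. -/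
open Real

/-- A function minimal at `a` among the points of a left neighbourhood has nonpositive
derivative there. -/
lemma deriv_nonpos_of_left_min {h : ℝ → ℝ} {h' a : ℝ} (hd : HasDerivAt h h' a)
    (hmin : ∀ᶠ r in nhdsWithin a (Set.Iio a), h a ≤ h r) : h' ≤ 0 := by
  have ht := (hasDerivWithinAt_iff_tendsto_slope' (Set.self_notMem_Iio)).1
    (hd.hasDerivWithinAt (s := Set.Iio a))
  refine le_of_tendsto ht ?_
  filter_upwards [hmin, self_mem_nhdsWithin] with r hr hra
  rw [slope_def_field]
  exact div_nonpos_of_nonneg_of_nonpos (by linarith) (by linarith [Set.mem_Iio.1 hra])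

/-- A function continuous in `z` and differentiable in `r` with `∂_r f ≥ -|z|²` is jointly lower
semicontinuous after adding `r |z|²`. -/
lemma lowerSemicontinuousOn_of_time_monotone {d : ℕ} {f : ℝ → (Fin d → ℝ) → ℝ} {a t : ℝ}
    (hft : ∀ r ∈ Set.Icc a t, ∀ z, DifferentiableAt ℝ (fun r => f r z) r)
    (hfx : ∀ r ∈ Set.Icc a t, Continuous (f r))
    (hge : ∀ r ∈ Set.Icc a t, ∀ z, -∑ j, (z j) ^ 2 ≤ deriv (fun r => f r z) r) :
    LowerSemicontinuousOn (fun p : ℝ × (Fin d → ℝ) => f p.1 p.2 + p.1 * ∑ j, (p.2 j) ^ 2)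
      (Set.Ioc a t ×ˢ Set.univ) := by
  have hder : ∀ r ∈ Set.Icc a t, ∀ z : Fin d → ℝ,
      HasDerivAt (fun r => f r z + r * ∑ j, (z j) ^ 2)
        (deriv (fun r => f r z) r + ∑ j, (z j) ^ 2) r := fun r hr z => by
    have h := (hft r hr z).hasDerivAt.add ((hasDerivAt_id r).mul_const (∑ j, (z j) ^ 2))
    rw [one_mul] at h
    exact h
  have hmono : ∀ z : Fin d → ℝ,
      MonotoneOn (fun r => f r z + r * ∑ j, (z j) ^ 2) (Set.Icc a t) := fun z => by
    refine monotoneOn_of_deriv_nonneg (convex_Icc a t)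
      (fun r hr => (hder r hr z).continuousAt.continuousWithinAt)
      (fun r hr => (hder r (interior_subset hr) z).differentiableAt.differentiableWithinAt)
      (fun r hr => ?_)
    rw [(hder r (interior_subset hr) z).deriv]
    linarith [hge r (interior_subset hr) z]
  rintro ⟨r₀, z₀⟩ ⟨⟨har, hrt⟩, -⟩ c hc
  dsimp only at har hrt hc
  have hcont := (hder r₀ ⟨har.le, hrt⟩ z₀).continuousAt
  obtain ⟨r₁, hr₁, hr₁a, hr₁r⟩ : ∃ r₁, c < f r₁ z₀ + r₁ * ∑ j, (z₀ j) ^ 2 ∧ a < r₁ ∧ r₁ < r₀ := by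
    have h1 : ∀ᶠ r in nhdsWithin r₀ (Set.Iio r₀), c < f r z₀ + r * ∑ j, (z₀ j) ^ 2 :=
      (hcont.eventually (lt_mem_nhds hc)).filter_mono nhdsWithin_le_nhds
    have h2 : ∀ᶠ r in nhdsWithin r₀ (Set.Iio r₀), a < r :=
      (lt_mem_nhds har).filter_mono nhdsWithin_le_nhds
    obtain ⟨r, h, h', h''⟩ := (h1.and (h2.and self_mem_nhdsWithin)).exists
    exact ⟨r, h, h', h''⟩
  have hr₁m : r₁ ∈ Set.Icc a t := ⟨hr₁a.le, hr₁r.le.trans hrt⟩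
  have hz : ∀ᶠ z in nhds z₀, c < f r₁ z + r₁ * ∑ j, (z j) ^ 2 := by
    have : Continuous (fun z : Fin d → ℝ => f r₁ z + r₁ * ∑ j, (z j) ^ 2) :=
      (hfx r₁ hr₁m).add (by fun_prop)
    exact this.continuousAt.eventually (lt_mem_nhds hr₁)
  have hboth : ∀ᶠ p : ℝ × (Fin d → ℝ) in nhds (r₀, z₀),
      r₁ < p.1 ∧ c < f r₁ p.2 + r₁ * ∑ j, (p.2 j) ^ 2 := by
    rw [nhds_prod_eq]
    exact (lt_mem_nhds hr₁r).prod_mk hz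
  filter_upwards [hboth.filter_mono nhdsWithin_le_nhds, self_mem_nhdsWithin] with p hp hps
  exact hp.2.trans_le (hmono p.2 hr₁m ⟨hps.1.1.le, hps.1.2⟩ hp.1.le)

/-- Comparison along the segment from `(s, x)` to `(s + L, x + L v)` for separately differentiable
solutions of the Hamilton–Jacobi inequality `|∇f|² - ∂_t f ≤ |z|²`, up to an error `ε`. The
comparison function is a steep paraboloid moving along the segment. -/
lemma hamiltonJacobi_segment_approx {d : ℕ} {f : ℝ → (Fin d → ℝ) → ℝ} {a s t : ℝ}
    (has : a < s) (hst : s < t)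
    (hft : ∀ r ∈ Set.Icc a t, ∀ z, DifferentiableAt ℝ (fun r => f r z) r)
    (hfx : ∀ r ∈ Set.Icc a t, Differentiable ℝ (f r))
    (hHJ : ∀ r ∈ Set.Icc a t, ∀ z,
      ∑ j, (pd (f r) j z) ^ 2 - deriv (fun r => f r z) r ≤ ∑ j, (z j) ^ 2)
    (x v : Fin d → ℝ) {ε : ℝ} (hε : 0 < ε) :
    f s x - (t - s) * ((∑ j, (v j) ^ 2) / 4 + ε) - ((t - s) * ∑ j, (x j) ^ 2
        + (t - s) ^ 2 * ∑ j, x j * v j + (t - s) ^ 3 / 3 * ∑ j, (v j) ^ 2) - ε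
      ≤ f t (x + (t - s) • v) := by
  set V := ∑ j, (v j) ^ 2 with hV
  set X := ∑ j, (x j) ^ 2 with hX
  set P := ∑ j, x j * v j with hP
  set A : ℝ → ℝ := fun r => f s x - (r - s) * (V / 4 + ε)
    - ((r - s) * X + (r - s) ^ 2 * P + (r - s) ^ 3 / 3 * V) with hA
  set γ : ℝ → Fin d → ℝ := fun r => x + (r - s) • v with hγ
  have hγc : Continuous γ := by fun_prop
  have hγs : γ s = x := by simp [hγ]
  have hsI : s ∈ Set.Icc a t := ⟨has.le, hst.le⟩
  have hsub : Set.Icc s t ⊆ Set.Icc a t := Set.Icc_subset_Icc_left has.le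
  -- a bound for the segment
  obtain ⟨M, hM0, hM⟩ : ∃ M : ℝ, 0 ≤ M ∧ ∀ r ∈ Set.Icc s t, ∀ j, |γ r j| ≤ M := by
    refine ⟨‖x‖ + (t - s) * ‖v‖, by have := sub_pos.2 hst; positivity, fun r hr j => ?_⟩
    have h1 : ‖γ r j‖ ≤ ‖γ r‖ := norm_le_pi_norm _ j
    have h2 : ‖γ r‖ ≤ ‖x‖ + ‖(r - s) • v‖ := norm_add_le _ _
    rw [norm_smul, Real.norm_of_nonneg (sub_nonneg.2 hr.1)] at h2
    have h3 : (r - s) * ‖v‖ ≤ (t - s) * ‖v‖ := by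
      gcongr
      exact hr.2
    rw [← Real.norm_eq_abs]
    linarith
  -- the radius of the tube
  obtain ⟨δ, hδ, hδ1, hδε, hδf⟩ : ∃ δ : ℝ, 0 < δ ∧ δ ≤ 1 ∧ δ * (d * (2 * M + 1) + 1) ≤ ε / 2 ∧
      ∀ z, ‖z - x‖ ≤ δ → f s x - ε ≤ f s z := by
    have hcs := (hfx s hsI).continuous.continuousAt (x := x)
    obtain ⟨δ₀, hδ₀, h⟩ := Metric.continuousAt_iff.1 hcs ε hε
    have hq : 0 < (d : ℝ) * (2 * M + 1) + 1 := by positivity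
    refine ⟨min (δ₀ / 2) (min 1 (ε / 2 / (d * (2 * M + 1) + 1))), by positivity,
      (min_le_right _ _).trans (min_le_left _ _), ?_, fun z hz => ?_⟩
    · rw [← le_div_iff₀ hq]
      exact (min_le_right _ _).trans (min_le_right _ _)
    · have hz' : dist z x < δ₀ := by
        rw [dist_eq_norm]
        linarith [hz.trans (min_le_left _ _)]
      have := h hz'
      rw [Real.dist_eq] at this
      linarith [(abs_lt.1 this).1]
  -- the tube
  set S : Set (ℝ × (Fin d → ℝ)) := {p | p.1 ∈ Set.Icc s t ∧ ‖p.2 - γ p.1‖ ≤ δ} with hS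
  have hScomp : IsCompact S := by
    have himg : S = (fun p : ℝ × (Fin d → ℝ) => (p.1, γ p.1 + p.2)) ''
        (Set.Icc s t ×ˢ Metric.closedBall 0 δ) := by
      ext ⟨r, z⟩
      constructor
      · rintro ⟨h1, h2⟩
        exact ⟨(r, z - γ r), ⟨h1, by simpa using h2⟩, by simp⟩
      · rintro ⟨⟨r', w⟩, ⟨h1, h2⟩, h3⟩
        simp only [Prod.mk.injEq] at h3
        obtain ⟨rfl, rfl⟩ := h3
        exact ⟨h1, by simpa using h2⟩
    rw [himg]
    exact (isCompact_Icc.prod (isCompact_closedBall 0 δ)).image (by fun_prop)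
  have hSne : (s, x) ∈ S := ⟨⟨le_rfl, hst.le⟩, by simp [hγs, hδ.le]⟩
  have hge : ∀ r ∈ Set.Icc a t, ∀ z, -∑ j, (z j) ^ 2 ≤ deriv (fun r => f r z) r := by
    intro r hr z
    have : 0 ≤ ∑ j, (pd (f r) j z) ^ 2 := Finset.sum_nonneg fun j _ => sq_nonneg _
    linarith [hHJ r hr z]
  have hlsc : LowerSemicontinuousOn
      (fun p : ℝ × (Fin d → ℝ) => f p.1 p.2 + p.1 * ∑ j, (p.2 j) ^ 2) S :=
    (lowerSemicontinuousOn_of_time_monotone hft (fun r hr => (hfx r hr).continuous) hge).mono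
      fun p hp => ⟨⟨has.trans_le hp.1.1, hp.1.2⟩, trivial⟩
  have hlscf : LowerSemicontinuousOn (fun p : ℝ × (Fin d → ℝ) => f p.1 p.2) S := by
    have hc : Continuous fun p : ℝ × (Fin d → ℝ) => -(p.1 * ∑ j, (p.2 j) ^ 2) := by fun_prop
    have := hlsc.add (hc.lowerSemicontinuous.lowerSemicontinuousOn S)
    simpa using this
  obtain ⟨q, -, hq⟩ := hlscf.exists_isMinOn ⟨_, hSne⟩ hScomp
  set m := f q.1 q.2
  have hm : ∀ p ∈ S, m ≤ f p.1 p.2 := fun p hp => hq hp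
  obtain ⟨K, hK0, hK⟩ : ∃ K : ℝ, 0 ≤ K ∧ f s x - m ≤ K * δ ^ 2 := by
    refine ⟨|f s x - m| / δ ^ 2, by positivity, ?_⟩
    rw [div_mul_cancel₀ _ (by positivity)]
    exact le_abs_self _
  have hAle : ∀ r ∈ Set.Icc s t, A r ≤ f s x := by
    intro r hr
    have hτ : 0 ≤ r - s := sub_nonneg.2 hr.1
    have h1 : 0 ≤ (r - s) * (V / 4 + ε) := by
      have : 0 ≤ V := Finset.sum_nonneg fun j _ => sq_nonneg _
      positivity
    have h2 : (r - s) * X + (r - s) ^ 2 * P + (r - s) ^ 3 / 3 * V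
        = ∑ j, (r - s) * ((x j + (r - s) * v j / 2) ^ 2 + ((r - s) * v j) ^ 2 / 12) := by
      rw [hX, hP, hV, Finset.mul_sum, Finset.mul_sum, Finset.mul_sum, ← Finset.sum_add_distrib,
        ← Finset.sum_add_distrib]
      exact Finset.sum_congr rfl fun j _ => by ring
    have h3 : 0 ≤ ∑ j, (r - s) * ((x j + (r - s) * v j / 2) ^ 2 + ((r - s) * v j) ^ 2 / 12) :=
      Finset.sum_nonneg fun j _ => by positivity
    simp only [hA]
    linarith
  set H : ℝ × (Fin d → ℝ) → ℝ := fun p => f p.1 p.2 - A p.1 + K * ∑ j, (p.2 j - γ p.1 j) ^ 2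
    with hH
  have hHlsc : LowerSemicontinuousOn H S := by
    have hc : Continuous fun p : ℝ × (Fin d → ℝ) =>
        -A p.1 + K * ∑ j, (p.2 j - γ p.1 j) ^ 2 := by fun_prop
    have hHeq : H = fun p => f p.1 p.2 + (-A p.1 + K * ∑ j, (p.2 j - γ p.1 j) ^ 2) := by
      funext p
      simp only [hH]
      ring
    rw [hHeq]
    exact hlscf.add (hc.lowerSemicontinuous.lowerSemicontinuousOn S)
  obtain ⟨⟨r₀, z₀⟩, hpS, hmin⟩ := hHlsc.exists_isMinOn ⟨_, hSne⟩ hScomp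
  have hminH : ∀ p ∈ S, H (r₀, z₀) ≤ H p := fun p hp => hmin hp
  have hend : (t, γ t) ∈ S := ⟨⟨hst.le, le_rfl⟩, by simp [hδ.le]⟩
  suffices hkey : -ε ≤ H (r₀, z₀) by
    have := hkey.trans (hminH _ hend)
    simp only [hH, hA, sub_self] at this
    simp only [ne_eq, OfNat.ofNat_ne_zero, not_false_eq_true, zero_pow, Finset.sum_const_zero,
      mul_zero, add_zero] at this
    change _ ≤ f t (γ t)
    linarith
  by_contra! hneg
  have hr₀ : r₀ ∈ Set.Icc s t := hpS.1
  have hw₀ : ‖z₀ - γ r₀‖ ≤ δ := hpS.2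
  have hsne : r₀ ≠ s := by
    rintro rfl
    rw [hγs] at hw₀
    have h1 := hδf z₀ hw₀
    have h2 : 0 ≤ K * ∑ j, (z₀ j - γ r₀ j) ^ 2 :=
      mul_nonneg hK0 (Finset.sum_nonneg fun j _ => sq_nonneg _)
    have h3 := hAle r₀ hr₀
    simp only [hH] at hneg
    linarith
  have hsr : s < r₀ := lt_of_le_of_ne hr₀.1 hsne.symm
  have hwlt : ‖z₀ - γ r₀‖ < δ := by
    refine lt_of_le_of_ne hw₀ fun heq => ?_
    have h1 : δ ^ 2 ≤ ∑ j, (z₀ j - γ r₀ j) ^ 2 := by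
      by_contra! hlt
      refine lt_irrefl δ ?_
      have : ‖z₀ - γ r₀‖ < δ := by
        refine (pi_norm_lt_iff hδ).2 fun j => ?_
        refine lt_of_pow_lt_pow_left₀ 2 hδ.le (lt_of_le_of_lt ?_ hlt)
        have := Finset.single_le_sum (f := fun j => (z₀ j - γ r₀ j) ^ 2)
          (fun i _ => sq_nonneg _) (Finset.mem_univ j)
        simpa using this
      linarith
    have h2 := mul_le_mul_of_nonneg_left h1 hK0
    have h3 := hAle r₀ hr₀
    have h4 := hm _ hpS
    simp only [hH] at hneg
    linarith
  -- first-order conditions at the minimum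
  have hspace : ∀ j, pd (f r₀) j z₀ = -(2 * K * (z₀ j - γ r₀ j)) := by
    intro j
    have hdf : HasDerivAt (fun q => f r₀ (Function.update z₀ j q)) (pd (f r₀) j z₀) (z₀ j) := by
      refine DifferentiableAt.hasDerivAt ?_
      exact ((hfx r₀ (hsub hr₀)) _).comp (z₀ j)
        (hasDerivAt_update z₀ j (z₀ j)).differentiableAt
    have hdq : HasDerivAt (fun q => ∑ i, (Function.update z₀ j q i - γ r₀ i) ^ 2)
        (2 * (z₀ j - γ r₀ j)) (z₀ j) := by
      have h1 : ∀ i ∈ Finset.univ, HasDerivAt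
          (fun q => (Function.update z₀ j q i - γ r₀ i) ^ 2)
          (2 * (z₀ i - γ r₀ i) * (Pi.single j (1 : ℝ) : Fin d → ℝ) i) (z₀ j) := by
        intro i _
        have := (((hasDerivAt_pi.1 (hasDerivAt_update z₀ j (z₀ j))) i).sub_const (γ r₀ i)).pow 2
        refine this.congr_deriv ?_
        simp
      have h2 := HasDerivAt.fun_sum h1
      simpa [Pi.single_apply] using h2
    have hdH : HasDerivAt (fun q => H (r₀, Function.update z₀ j q))
        (pd (f r₀) j z₀ + K * (2 * (z₀ j - γ r₀ j))) (z₀ j) :=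
      (hdf.sub_const (A r₀)).add (hdq.const_mul K)
    have hloc : IsLocalMin (fun q => H (r₀, Function.update z₀ j q)) (z₀ j) := by
      have hc : ContinuousAt (fun q : ℝ => ‖Function.update z₀ j q - γ r₀‖) (z₀ j) := by
        fun_prop
      have hev := hc.eventually_lt_const (u := δ) (by simpa using hwlt)
      filter_upwards [hev] with q hq
      have := hminH (r₀, Function.update z₀ j q) ⟨hr₀, hq.le⟩
      simpa using this
    have := hloc.hasDerivAt_eq_zero hdH
    linarith
  have htime : deriv (fun r => f r z₀) r₀
      ≤ -(V / 4 + ε) - (X + 2 * (r₀ - s) * P + (r₀ - s) ^ 2 * V)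
        + K * ∑ j, 2 * (z₀ j - γ r₀ j) * v j := by
    have hτ : HasDerivAt (fun r : ℝ => r - s) 1 r₀ := (hasDerivAt_id r₀).sub_const s
    have hdA : HasDerivAt A
        (-(V / 4 + ε) - (X + 2 * (r₀ - s) * P + (r₀ - s) ^ 2 * V)) r₀ := by
      have := ((hτ.mul_const (V / 4 + ε)).const_sub (f s x)).sub
        (((hτ.mul_const X).add ((hτ.pow 2).mul_const P)).add
          (((hτ.pow 3).div_const 3).mul_const V))
      refine this.congr_deriv ?_
      norm_num
    have hdq : HasDerivAt (fun r => ∑ j, (z₀ j - γ r j) ^ 2)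
        (∑ j, -(2 * (z₀ j - γ r₀ j) * v j)) r₀ := by
      refine HasDerivAt.fun_sum fun j _ => ?_
      have := (((hτ.mul_const (v j)).const_add (x j)).const_sub (z₀ j)).pow 2
      refine this.congr_deriv ?_
      simp [hγ]
    have hdH : HasDerivAt (fun r => H (r, z₀)) _ r₀ :=
      ((hft r₀ (hsub hr₀) z₀).hasDerivAt.sub hdA).add (hdq.const_mul K)
    have hle := deriv_nonpos_of_left_min hdH (by
      have hc : ContinuousAt (fun r : ℝ => ‖z₀ - γ r‖) r₀ := by fun_prop
      have hev := (hc.eventually_lt_const hwlt).filter_mono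
        (nhdsWithin_le_nhds (s := Set.Iio r₀))
      have hev' : ∀ᶠ r in nhdsWithin r₀ (Set.Iio r₀), s < r :=
        (lt_mem_nhds hsr).filter_mono nhdsWithin_le_nhds
      filter_upwards [hev, hev', self_mem_nhdsWithin] with r h1 h2 h3
      exact hminH (r, z₀) ⟨⟨h2.le, (Set.mem_Iio.1 h3).le.trans hr₀.2⟩, h1.le⟩)
    rw [Finset.sum_neg_distrib] at hle
    linarith
  have hHJ₀ := hHJ r₀ (hsub hr₀) z₀
  have hsmall : ∑ j, (2 * γ r₀ j * (z₀ j - γ r₀ j) + (z₀ j - γ r₀ j) ^ 2)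
      ≤ d * ((2 * M + 1) * δ) := by
    have : ∀ j ∈ Finset.univ,
        2 * γ r₀ j * (z₀ j - γ r₀ j) + (z₀ j - γ r₀ j) ^ 2 ≤ (2 * M + 1) * δ := by
      intro j _
      have h1 : |z₀ j - γ r₀ j| ≤ δ := (norm_le_pi_norm (z₀ - γ r₀) j).trans hw₀
      have h2 : γ r₀ j * (z₀ j - γ r₀ j) ≤ M * δ := by
        refine (le_abs_self _).trans ?_
        rw [abs_mul]
        exact mul_le_mul (hM r₀ hr₀ j) h1 (abs_nonneg _) hM0
      have h3 : (z₀ j - γ r₀ j) ^ 2 ≤ δ := by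
        rw [← sq_abs]
        nlinarith [abs_nonneg (z₀ j - γ r₀ j)]
      linarith
    have := Finset.sum_le_sum this
    simpa using this
  have hident : ∑ j, (pd (f r₀) j z₀) ^ 2 + V / 4
      + (X + 2 * (r₀ - s) * P + (r₀ - s) ^ 2 * V) - K * ∑ j, 2 * (z₀ j - γ r₀ j) * v j
      - ∑ j, (z₀ j) ^ 2
      = ∑ j, (v j / 2 - 2 * K * (z₀ j - γ r₀ j)) ^ 2
        - ∑ j, (2 * γ r₀ j * (z₀ j - γ r₀ j) + (z₀ j - γ r₀ j) ^ 2) := by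
    rw [hX, hP, hV, Finset.sum_div, Finset.mul_sum, Finset.mul_sum, Finset.mul_sum,
      ← Finset.sum_add_distrib, ← Finset.sum_add_distrib, ← Finset.sum_add_distrib,
      ← Finset.sum_add_distrib, ← Finset.sum_sub_distrib, ← Finset.sum_sub_distrib,
      ← Finset.sum_sub_distrib]
    refine Finset.sum_congr rfl fun j _ => ?_
    rw [hspace j]
    simp only [hγ, Pi.add_apply, Pi.smul_apply, smul_eq_mul]
    ring
  have hsq : 0 ≤ ∑ j, (v j / 2 - 2 * K * (z₀ j - γ r₀ j)) ^ 2 :=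
    Finset.sum_nonneg fun j _ => sq_nonneg _
  nlinarith

/-- Integrated form of the Hamilton–Jacobi inequality `|∇f|² - ∂_t f ≤ |z|²` along the segment
joining `(s, x)` to `(t, y)`. -/
lemma hamiltonJacobi_le {d : ℕ} {f : ℝ → (Fin d → ℝ) → ℝ} {a s t : ℝ}
    (has : a < s) (hst : s < t)
    (hft : ∀ r ∈ Set.Icc a t, ∀ z, DifferentiableAt ℝ (fun r => f r z) r)
    (hfx : ∀ r ∈ Set.Icc a t, Differentiable ℝ (f r))
    (hHJ : ∀ r ∈ Set.Icc a t, ∀ z,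
      ∑ j, (pd (f r) j z) ^ 2 - deriv (fun r => f r z) r ≤ ∑ j, (z j) ^ 2)
    (x y : Fin d → ℝ) :
    f s x ≤ f t y + ((∑ j, (x j - y j) ^ 2) / (4 * (t - s))
      + (t - s) * (((∑ j, (x j) ^ 2) + (∑ j, (y j) ^ 2) + ∑ j, x j * y j) / 3)) := by
  have hτ : 0 < t - s := sub_pos.2 hst
  refine le_of_forall_pos_le_add fun η hη => ?_
  have hε : 0 < η / (t - s + 1) := by positivity
  have h := hamiltonJacobi_segment_approx has hst hft hfx hHJ x ((t - s)⁻¹ • (y - x)) hε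
  rw [smul_inv_smul₀ hτ.ne', add_sub_cancel] at h
  have hη' : (t - s) * (η / (t - s + 1)) + η / (t - s + 1) = η := by
    field_simp
  have hident : (t - s) * ((∑ j, (((t - s)⁻¹ • (y - x)) j) ^ 2) / 4)
      + ((t - s) * ∑ j, (x j) ^ 2 + (t - s) ^ 2 * ∑ j, x j * ((t - s)⁻¹ • (y - x)) j
        + (t - s) ^ 3 / 3 * ∑ j, (((t - s)⁻¹ • (y - x)) j) ^ 2)
      = (∑ j, (x j - y j) ^ 2) / (4 * (t - s))
        + (t - s) * (((∑ j, (x j) ^ 2) + (∑ j, (y j) ^ 2) + ∑ j, x j * y j) / 3) := by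
    simp only [← Finset.sum_add_distrib, Finset.sum_div, Finset.mul_sum]
    refine Finset.sum_congr rfl fun j _ => ?_
    simp only [Pi.smul_apply, Pi.sub_apply, smul_eq_mul]
    field_simp
    ring
  linarith

lemma sinh_div_sinh_le {a b : ℝ} (ha : 0 < a) (hab : a < b) :
    Real.sinh b / Real.sinh a ≤ b / a * Real.exp (b - a) := by
  have hb : 0 < b := ha.trans hab
  have hconv := convexOn_exp.2 (Set.mem_univ (-2 * b)) (Set.mem_univ (0 : ℝ))
    (show 0 ≤ a / b by positivity)
    (sub_nonneg.2 ((div_le_one hb).2 hab.le)) (by ring)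
  simp only [smul_eq_mul, mul_zero, add_zero, Real.exp_zero, mul_one] at hconv
  rw [show a / b * (-2 * b) = -2 * a by field_simp] at hconv
  have hmul : a * (1 - Real.exp (-2 * b)) ≤ b * (1 - Real.exp (-2 * a)) := by
    have := mul_le_mul_of_nonneg_left hconv hb.le
    have e : b * (a / b * Real.exp (-2 * b) + (1 - a / b))
        = a * Real.exp (-2 * b) + (b - a) := by
      field_simp
    linarith
  have hsinh : ∀ c : ℝ, Real.sinh c = Real.exp c * (1 - Real.exp (-2 * c)) / 2 := fun c => by
    rw [Real.sinh_eq, mul_sub, ← Real.exp_add]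
    ring_nf
  rw [div_le_iff₀ (Real.sinh_pos_iff.2 ha), hsinh, hsinh,
    show b / a * Real.exp (b - a) * (Real.exp a * (1 - Real.exp (-2 * a)) / 2)
      = (Real.exp (b - a) * Real.exp a) * (b * (1 - Real.exp (-2 * a))) / a / 2 by ring,
    ← Real.exp_add, sub_add_cancel]
  have : 1 - Real.exp (-2 * b) ≤ b * (1 - Real.exp (-2 * a)) / a := by
    rw [le_div_iff₀ ha]
    linarith
  have := mul_le_mul_of_nonneg_left this (Real.exp_pos b).le
  rw [div_le_div_iff_of_pos_right two_pos, mul_div_assoc]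
  exact this

/-- **Sharp parabolic Harnack inequality** from the Li–Yau gradient estimate: if a
positive function `u`, `C¹` in `t` and `C¹` in `x`, satisfies
`|∇u|²/u² − ∂_t u/u ≤ (d + 2λ) coth(2t) + |x|²` on `(0,T) × ℝ^d`, then for every
`0 < s < t < T` and `x, y ∈ ℝ^d`,
`u(s,x) ≤ u(t,y) (sinh(2t)/sinh(2s))^{(d+2λ)/2} exp(|x−y|²/(4(t−s)) + (t−s) ς(x,y))
       ≤ u(t,y) (t/s)^{(d+2λ)/2} exp(|x−y|²/(4(t−s)) + (t−s)[d+2λ+ς(x,y)])`,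
where `ς(x,y) = (|x|² + |y|² + ⟨x,y⟩)/3`. -/
theorem stmt5 (d : ℕ) (hd : 1 ≤ d) (lam : ℝ) (hlam : 0 ≤ lam)
    (T : EReal) (hT : 0 < T)
    (u : ℝ → (Fin d → ℝ) → ℝ)
    (hupos : ∀ (t : ℝ) x, 0 < t → (t : EReal) < T → 0 < u t x)
    (huC1t : ∀ x, ContDiffOn ℝ 1 (fun s => u s x) {s : ℝ | 0 < s ∧ (s : EReal) < T})
    (huC1x : ∀ (t : ℝ), 0 < t → (t : EReal) < T → ContDiff ℝ 1 (fun z => u t z))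
    (hLY : ∀ (t : ℝ) x, 0 < t → (t : EReal) < T →
      (∑ j, (pd (fun z => u t z) j x) ^ 2) / (u t x) ^ 2
          - deriv (fun s => u s x) t / u t x
        ≤ ((d : ℝ) + 2 * lam) * (Real.cosh (2*t) / Real.sinh (2*t)) + ∑ j, (x j) ^ 2)
    (s t : ℝ) (hs : 0 < s) (hst : s < t) (htT : (t : EReal) < T)
    (x y : Fin d → ℝ) :
    u s x ≤ u t y * (Real.sinh (2*t) / Real.sinh (2*s)) ^ (((d : ℝ) + 2 * lam) / 2)
          * Real.exp ((∑ j, (x j - y j) ^ 2) / (4 * (t - s))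
              + (t - s) * (((∑ j, (x j) ^ 2) + (∑ j, (y j) ^ 2) + ∑ j, x j * y j) / 3))
    ∧ u t y * (Real.sinh (2*t) / Real.sinh (2*s)) ^ (((d : ℝ) + 2 * lam) / 2)
          * Real.exp ((∑ j, (x j - y j) ^ 2) / (4 * (t - s))
              + (t - s) * (((∑ j, (x j) ^ 2) + (∑ j, (y j) ^ 2) + ∑ j, x j * y j) / 3))
        ≤ u t y * (t / s) ^ (((d : ℝ) + 2 * lam) / 2)
          * Real.exp ((∑ j, (x j - y j) ^ 2) / (4 * (t - s))
              + (t - s) * ((d : ℝ) + 2 * lam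
                + ((∑ j, (x j) ^ 2) + (∑ j, (y j) ^ 2) + ∑ j, x j * y j) / 3)) := by
  set c : ℝ := (d : ℝ) + 2 * lam with hc
  have hc0 : 0 ≤ c := by positivity
  have ht : 0 < t := hs.trans hst
  have hSs : 0 < Real.sinh (2 * s) := Real.sinh_pos_iff.2 (by linarith)
  have hSt : 0 < Real.sinh (2 * t) := Real.sinh_pos_iff.2 (by linarith)
  have hus : 0 < u s x := hupos s x hs (lt_trans (by exact_mod_cast hst) htT)
  have hut : 0 < u t y := hupos t y ht htT
  constructor
  · have hdom : ∀ r ∈ Set.Icc (s / 2) t, 0 < r ∧ (r : EReal) < T := fun r hr =>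
      ⟨by linarith [hr.1], lt_of_le_of_lt (by exact_mod_cast hr.2) htT⟩
    have hopen : IsOpen {r : ℝ | 0 < r ∧ (r : EReal) < T} :=
      (isOpen_lt continuous_const continuous_id).inter
        (isOpen_lt continuous_coe_real_ereal continuous_const)
    have hut' : ∀ r ∈ Set.Icc (s / 2) t, ∀ z, DifferentiableAt ℝ (fun r => u r z) r :=
      fun r hr z => ((huC1t z).differentiableOn one_ne_zero).differentiableAt
        (hopen.mem_nhds (hdom r hr))
    have hux' : ∀ r ∈ Set.Icc (s / 2) t, Differentiable ℝ (u r) := fun r hr =>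
      (huC1x r (hdom r hr).1 (hdom r hr).2).differentiable one_ne_zero
    have hup : ∀ r ∈ Set.Icc (s / 2) t, ∀ z, 0 < u r z := fun r hr z =>
      hupos r z (hdom r hr).1 (hdom r hr).2
    have hder : ∀ r ∈ Set.Icc (s / 2) t, ∀ z,
        HasDerivAt (fun r => Real.log (u r z) + c / 2 * Real.log (Real.sinh (2 * r)))
          (deriv (fun r => u r z) r / u r z
            + c * (Real.cosh (2 * r) / Real.sinh (2 * r))) r := by
      intro r hr z
      have hsr : 0 < Real.sinh (2 * r) := Real.sinh_pos_iff.2 (by linarith [(hdom r hr).1])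
      have h2 : HasDerivAt (fun r : ℝ => 2 * r) 2 r := by
        simpa using (hasDerivAt_id r).const_mul (2 : ℝ)
      refine (((hut' r hr z).hasDerivAt.log (hup r hr z).ne').add
        ((h2.sinh.log hsr.ne').const_mul (c / 2))).congr_deriv ?_
      ring
    have hlog := hamiltonJacobi_le
      (f := fun r z => Real.log (u r z) + c / 2 * Real.log (Real.sinh (2 * r)))
      (half_lt_self hs) hst (fun r hr z => (hder r hr z).differentiableAt)
      (fun r hr => ((hux' r hr).log fun z => (hup r hr z).ne').add_const _)
      (fun r hr z => by
        rw [(hder r hr z).deriv]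
        have hpd : ∀ j, pd (fun z => Real.log (u r z) + c / 2 * Real.log (Real.sinh (2 * r))) j z
            = pd (fun z => u r z) j z / u r z := by
          intro j
          have hdf : DifferentiableAt ℝ (fun q => u r (Function.update z j q)) (z j) :=
            ((hux' r hr) _).comp (z j) (hasDerivAt_update z j (z j)).differentiableAt
          have hne : u r (Function.update z j (z j)) ≠ 0 := (hup r hr _).ne'
          have := ((hdf.hasDerivAt.log hne).add_const
            (c / 2 * Real.log (Real.sinh (2 * r)))).deriv
          simpa [pd] using this
        simp only [hpd, div_pow]
        rw [← Finset.sum_div]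
        linarith [hLY r z (hdom r hr).1 (hdom r hr).2]) x y
    rw [← Real.log_le_log_iff hus (by positivity), Real.log_mul (by positivity) (by positivity),
      Real.log_mul (by positivity) (by positivity), Real.log_exp,
      Real.log_rpow (by positivity), Real.log_div hSt.ne' hSs.ne']
    linarith
  · have hratio := sinh_div_sinh_le (a := 2 * s) (b := 2 * t) (by linarith) (by linarith)
    rw [mul_div_mul_left _ _ (two_ne_zero' ℝ)] at hratio
    have hpow : (Real.sinh (2 * t) / Real.sinh (2 * s)) ^ (c / 2)
        ≤ (t / s) ^ (c / 2) * Real.exp ((t - s) * c) := by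
      refine (Real.rpow_le_rpow (by positivity) hratio (by positivity)).trans_eq ?_
      rw [Real.mul_rpow (by positivity) (Real.exp_pos _).le, ← Real.exp_mul]
      ring_nf
    rw [mul_add (t - s) c, add_left_comm, Real.exp_add ((t - s) * c), mul_assoc, mul_assoc,
      ← mul_assoc _ (Real.exp ((t - s) * c))]
    gcongr
end

section
/- Let T ∈ (0,∞] and let β : (0,T) × ℝ^d → ℝ be jointly continuous. Let u : (0,T) × ℝ^d → (0,∞) be C¹ in t and C¹ in x. If |∇u(t,·)(x)|²/u(t,x)² − ∂_t u(t,x)/u(t,x) ≤ β(t,x) for all (t,x) ∈ (0,T) × ℝ^d, then for every 0 < s < t < T and every x,y ∈ ℝ^d, u(s,x) ≤ u(t,y) exp{ |x−y|²/(4(t−s)) + (t−s) ∫_0^1 β(t + τ(s−t), y + τ(x−y)) dτ }. -/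
open Real MeasureTheory

open Set Filter Topology

theorem hasDerivAt_sum_sq_update_sub {d : ℕ} (z c : Fin d → ℝ) (j : Fin d) :
    HasDerivAt (fun σ => ∑ i, (Function.update z j σ i - c i) ^ 2) (2 * (z j - c j)) (z j) := by
  have h : ∀ i ∈ Finset.univ, HasDerivAt (fun σ => (Function.update z j σ i - c i) ^ 2)
      (if i = j then 2 * (z j - c j) else 0) (z j) := by
    intro i _
    by_cases hij : i = j
    · subst hij
      simpa using ((hasDerivAt_id (z i)).sub_const (c i)).fun_pow 2
    · simpa [Function.update_of_ne hij, hij] using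
        hasDerivAt_const (z j) ((z i - c i) ^ 2)
  simpa using HasDerivAt.fun_sum h

/-- The derivative is nonpositive at a minimum over an interval lying to the left. -/
theorem HasDerivAt.nonpos_of_forall_le_left {f : ℝ → ℝ} {f' s r : ℝ} (hf : HasDerivAt f f' r)
    (hsr : s < r) (hmin : ∀ q ∈ Icc s r, f r ≤ f q) : f' ≤ 0 := by
  have h := (hasDerivWithinAt_iff_tendsto_slope' (by simp)).1 (hf.hasDerivWithinAt (s := Iio r))
  refine le_of_tendsto h ?_
  filter_upwards [Ioo_mem_nhdsLT hsr] with q hq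
  rw [slope_def_field]
  exact div_nonpos_of_nonneg_of_nonpos (by linarith [hmin q ⟨hq.1.le, hq.2.le⟩])
    (by linarith [hq.2])

theorem lowerSemicontinuousOn_of_neg_deriv_le {X : Type*} [PseudoMetricSpace X] {a b : ℝ}
    {v β : ℝ → X → ℝ}
    (hβ : ContinuousOn (fun p : ℝ × X => β p.1 p.2) (Ioo a b ×ˢ univ))
    (hvt : ∀ r ∈ Ioo a b, ∀ z, DifferentiableAt ℝ (fun q => v q z) r)
    (hvx : ∀ r ∈ Ioo a b, Continuous (v r))
    (h : ∀ r ∈ Ioo a b, ∀ z, -deriv (fun q => v q z) r ≤ β r z) :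
    LowerSemicontinuousOn (fun p : ℝ × X => v p.1 p.2) (Ioo a b ×ˢ univ) := by
  rintro ⟨r₀, z₀⟩ ⟨hr₀, -⟩ m hm
  simp only at hr₀ hm
  have hnhds : Ioo a b ×ˢ (univ : Set X) ∈ 𝓝 (r₀, z₀) :=
    prod_mem_nhds (Ioo_mem_nhds hr₀.1 hr₀.2) univ_mem
  obtain ⟨C, hC0, hC⟩ : ∃ C : ℝ, 0 ≤ C ∧ ∀ᶠ p : ℝ × X in 𝓝 (r₀, z₀), β p.1 p.2 < C := by
    refine ⟨|β r₀ z₀| + 1, by positivity, (hβ.continuousAt hnhds).eventually_lt_const ?_⟩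
    exact (le_abs_self _).trans_lt (lt_add_one _)
  obtain ⟨δ, hδ, hball⟩ := Metric.eventually_nhds_iff.1 (hC.and hnhds)
  obtain ⟨r₁, hr₁, hr₁r₀, hvr₁⟩ : ∃ r₁, r₀ - δ < r₁ ∧ r₁ < r₀ ∧
      m < v r₁ z₀ - 2 * C * (r₀ - r₁) := by
    have hc : ContinuousAt (fun q => v q z₀ - 2 * C * (r₀ - q)) r₀ :=
      (hvt r₀ hr₀ z₀).continuousAt.sub (by fun_prop)
    have hev := (hc.eventually_const_lt (by simpa using hm)).filter_mono
      (nhdsWithin_le_nhds (s := Iio r₀))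
    obtain ⟨r₁, h₁, h₂⟩ := (hev.and (Ioo_mem_nhdsLT (sub_lt_self r₀ hδ))).exists
    exact ⟨r₁, h₂.1, h₂.2, h₁⟩
  have hmem : ∀ q, |q - r₀| < δ → ∀ z, dist z z₀ < δ → β q z < C ∧ q ∈ Ioo a b := by
    intro q hq z hz
    have := @hball (q, z) (by simpa [Prod.dist_eq, Real.dist_eq] using ⟨hq, hz⟩)
    exact ⟨this.1, this.2.1⟩
  have hr₁ab : r₁ ∈ Ioo a b :=
    (hmem r₁ (abs_lt.2 ⟨by linarith, by linarith⟩) z₀ (by simpa using hδ)).2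
  have hz : ∀ᶠ z in 𝓝 z₀, m < v r₁ z - 2 * C * (r₀ - r₁) :=
    ((hvx r₁ hr₁ab).sub continuous_const).continuousAt.eventually_const_lt hvr₁
  have hr : ∀ᶠ r in 𝓝 r₀, r ∈ Ioo r₁ (r₀ + (r₀ - r₁)) :=
    Ioo_mem_nhds hr₁r₀ (by linarith)
  refine nhdsWithin_le_nhds ?_
  filter_upwards [hr.prod_inl_nhds z₀, (hz.and (Metric.ball_mem_nhds z₀ hδ)).prod_inr_nhds r₀]
  rintro ⟨r, z⟩ hr ⟨hzv, hzδ⟩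
  simp only [mem_Ioo] at hr hzv hzδ ⊢
  have hI : ∀ q ∈ Icc r₁ r, β q z < C ∧ q ∈ Ioo a b := fun q hq =>
    hmem q (abs_lt.2 ⟨by linarith [hq.1], by linarith [hq.2]⟩) z hzδ
  have hd : ∀ q ∈ Icc r₁ r, HasDerivAt (fun q => v q z + C * q)
      (deriv (fun q => v q z) q + C * 1) q := fun q hq =>
    (hvt q (hI q hq).2 z).hasDerivAt.add ((hasDerivAt_id q).const_mul C)
  have hmono : MonotoneOn (fun q => v q z + C * q) (Icc r₁ r) := by
    refine monotoneOn_of_deriv_nonneg (convex_Icc _ _)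
      (fun q hq => (hd q hq).continuousAt.continuousWithinAt)
      (fun q hq => (hd q (interior_subset hq)).differentiableAt.differentiableWithinAt) ?_
    intro q hq
    have hq := interior_subset hq
    rw [(hd q hq).deriv]
    linarith [h q (hI q hq).2 z, (hI q hq).1]
  have := hmono ⟨le_rfl, hr.1.le⟩ ⟨hr.1.le, le_rfl⟩ hr.1.le
  simp only at this
  nlinarith [mul_nonneg hC0 (sub_nonneg.2 hr.2.le)]

/-- A separately differentiable `v` with `|∇v|² - ∂ₜv ≤ β` satisfies the Harnack inequality.
Joint differentiability of `v` is not needed: at a minimum of the penalized function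
`v + ∫ β + K |z - γ|²` the two partial derivatives can be compared separately. -/
theorem le_add_integral_of_sum_sq_pd_sub_deriv_le {d : ℕ} {a b s t : ℝ}
    (has : a < s) (hst : s < t) (htb : t < b) {v β : ℝ → (Fin d → ℝ) → ℝ}
    (hβ : ContinuousOn (fun p : ℝ × (Fin d → ℝ) => β p.1 p.2) (Ioo a b ×ˢ univ))
    (hvt : ∀ r ∈ Ioo a b, ∀ z, DifferentiableAt ℝ (fun q => v q z) r)
    (hvx : ∀ r ∈ Ioo a b, Differentiable ℝ (v r))
    (h : ∀ r ∈ Ioo a b, ∀ z, ∑ j, pd (v r) j z ^ 2 - deriv (fun q => v q z) r ≤ β r z)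
    (x y : Fin d → ℝ) :
    v s x ≤ v t y + ((∑ j, (x j - y j) ^ 2) / (4 * (t - s))
      + ∫ r in s..t, β r (y + ((t - r) / (t - s)) • (x - y))) := by
  have hts : 0 < t - s := sub_pos.2 hst
  have hsub : Icc s t ⊆ Ioo a b := fun r hr => ⟨has.trans_le hr.1, hr.2.trans_lt htb⟩
  set γ : ℝ → Fin d → ℝ := fun r => y + ((t - r) / (t - s)) • (x - y) with hγ
  have hγc : Continuous γ := by fun_prop
  have hγs : γ s = x := by simp [hγ, div_self hts.ne']
  have hγt : γ t = y := by simp [hγ]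
  have hγd : ∀ r j, HasDerivAt (fun q => γ q j) ((y j - x j) / (t - s)) r := by
    intro r j
    have := ((((hasDerivAt_id r).const_sub t).div_const (t - s)).mul_const
      (x j - y j)).const_add (y j)
    exact this.congr_deriv (by ring)
  have hγy : ∀ r ∈ Icc s t, dist (γ r) y ≤ dist x y := by
    intro r hr
    have h0 : 0 ≤ (t - r) / (t - s) := div_nonneg (by linarith [hr.2]) hts.le
    have h1 : (t - r) / (t - s) ≤ 1 := (div_le_one hts).2 (by linarith [hr.1])
    rw [dist_eq_norm, dist_eq_norm, hγ, add_sub_cancel_left, norm_smul, Real.norm_of_nonneg h0]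
    exact mul_le_of_le_one_left (norm_nonneg _) h1
  set A : ℝ := (∑ j, (x j - y j) ^ 2) / (4 * (t - s) ^ 2) with hA
  have hfc : ContinuousOn (fun r => β r (γ r)) (Ioo a b) :=
    hβ.comp (continuous_id.prodMk hγc).continuousOn (fun r hr => ⟨hr, mem_univ _⟩)
  set G : ℝ → ℝ := fun r => (∫ ρ in s..r, β ρ (γ ρ)) + A * (r - s) with hG
  have hGd : ∀ r ∈ Icc s t, HasDerivAt G (β r (γ r) + A) r := by
    intro r hr
    have hrab := hsub hr
    have hint : IntervalIntegrable (fun r => β r (γ r)) volume s r := by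
      refine (hfc.mono ?_).intervalIntegrable
      rw [uIcc_of_le hr.1]
      exact fun q hq => hsub ⟨hq.1, hq.2.trans hr.2⟩
    have h1 := intervalIntegral.integral_hasDerivAt_right hint
      (hfc.stronglyMeasurableAtFilter isOpen_Ioo r hrab)
      (hfc.continuousAt (Ioo_mem_nhds hrab.1 hrab.2))
    simpa using h1.fun_add (((hasDerivAt_id r).sub_const s).const_mul A)
  have hGs : G s = 0 := by simp [hG]
  have hGt : G t = (∑ j, (x j - y j) ^ 2) / (4 * (t - s)) + ∫ r in s..t, β r (γ r) := by
    have : A * (t - s) = (∑ j, (x j - y j) ^ 2) / (4 * (t - s)) := by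
      rw [hA]; field_simp
    simp only [hG, this]; ring
  rw [← hGt]
  suffices key : ∀ ε > 0, v s x ≤ v t y + G t + ε * (t - s + 1) by
    refine le_of_forall_pos_le_add fun ε hε => ?_
    have := key (ε / (t - s + 1)) (by positivity)
    rwa [div_mul_cancel₀ _ (by positivity)] at this
  intro ε hε
  set B : Set (Fin d → ℝ) := Metric.closedBall y (dist x y + 1) with hB
  set Q : Set (ℝ × (Fin d → ℝ)) := Icc s t ×ˢ B with hQ
  have hQc : IsCompact Q := isCompact_Icc.prod (isCompact_closedBall _ _)
  have hQsub : Q ⊆ Ioo a b ×ˢ univ := prod_mono hsub (subset_univ _)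
  have hγQ : ∀ r ∈ Icc s t, (r, γ r) ∈ Q := fun r hr =>
    ⟨hr, Metric.mem_closedBall.2 ((hγy r hr).trans (by linarith))⟩
  have hlsc : LowerSemicontinuousOn (fun p : ℝ × (Fin d → ℝ) => v p.1 p.2) Q := by
    refine (lowerSemicontinuousOn_of_neg_deriv_le hβ hvt (fun r hr => (hvx r hr).continuous)
      fun r hr z => ?_).mono hQsub
    have : 0 ≤ ∑ j, pd (v r) j z ^ 2 := by positivity
    linarith [h r hr z]
  have hGc : ContinuousOn (fun p : ℝ × (Fin d → ℝ) => G p.1 + ε * (p.1 - s)) Q := by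
    refine ContinuousOn.add (ContinuousOn.comp (t := Icc s t) (g := G) (fun r hr =>
      (hGd r hr).continuousAt.continuousWithinAt) continuous_fst.continuousOn
      fun p hp => hp.1) (by fun_prop)
  have hQne : Q.Nonempty := ⟨_, hγQ t ⟨hst.le, le_rfl⟩⟩
  have hlsc' := hlsc.add hGc.lowerSemicontinuousOn
  obtain ⟨p₀, hp₀, hmin₀⟩ := hlsc'.exists_isMinOn hQne hQc
  obtain ⟨ρ₁, hρ₁, hβρ⟩ := Metric.uniformContinuousOn_iff.1
    (hQc.uniformContinuousOn_of_continuous (hβ.mono hQsub)) ε hε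
  obtain ⟨ρ₂, hρ₂, hvρ⟩ := Metric.continuousAt_iff.1
    ((hvx s (hsub ⟨le_rfl, hst.le⟩)) x).continuousAt ε hε
  set ρ : ℝ := min 1 (min ρ₁ ρ₂) with hρ
  have hρ0 : 0 < ρ := by positivity
  set Φ₀ : ℝ × (Fin d → ℝ) → ℝ := fun p => v p.1 p.2 + (G p.1 + ε * (p.1 - s)) with hΦ₀
  have hgap : 0 ≤ Φ₀ (t, y) - Φ₀ p₀ := by
    have := isMinOn_iff.1 hmin₀ (t, y) (by simpa [hγt] using hγQ t ⟨hst.le, le_rfl⟩)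
    exact sub_nonneg.2 this
  set K : ℝ := (Φ₀ (t, y) - Φ₀ p₀ + 1) / ρ ^ 2 with hK
  have hK0 : 0 < K := by positivity
  have hKρ : K * ρ ^ 2 = Φ₀ (t, y) - Φ₀ p₀ + 1 := by rw [hK]; field_simp
  have hpen : ContinuousOn (fun p : ℝ × (Fin d → ℝ) => K * ∑ j, (p.2 j - γ p.1 j) ^ 2) Q := by
    fun_prop
  obtain ⟨⟨r, z⟩, ⟨hr, hz⟩, hmin⟩ :=
    (hlsc'.add hpen.lowerSemicontinuousOn).exists_isMinOn hQne hQc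
  replace hmin : ∀ q ∈ Icc s t, ∀ w ∈ B, Φ₀ (r, z) + K * ∑ j, (z j - γ r j) ^ 2 ≤
      Φ₀ (q, w) + K * ∑ j, (w j - γ q j) ^ 2 :=
    fun q hq w hw => isMinOn_iff.1 hmin (q, w) ⟨hq, hw⟩
  simp only at hr hz
  have hle : Φ₀ (r, z) + K * ∑ j, (z j - γ r j) ^ 2 ≤ Φ₀ (t, y) := by
    simpa [hγt] using hmin t ⟨hst.le, le_rfl⟩ y (by simpa [hγt] using (hγQ t ⟨hst.le, le_rfl⟩).2)
  have hzγ : dist z (γ r) < ρ := by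
    have h0 : Φ₀ p₀ ≤ Φ₀ (r, z) := isMinOn_iff.1 hmin₀ (r, z) ⟨hr, hz⟩
    have h1 : ∑ j, (z j - γ r j) ^ 2 < ρ ^ 2 := by
      refine lt_of_mul_lt_mul_left (a := K) ?_ hK0.le
      linarith
    refine (dist_pi_lt_iff hρ0).2 fun j => ?_
    rw [Real.dist_eq]
    refine abs_lt_of_sq_lt_sq ((Finset.single_le_sum (f := fun j => (z j - γ r j) ^ 2)
      (fun i _ => sq_nonneg _) (Finset.mem_univ j)).trans_lt h1) hρ0.le
  rcases hr.1.eq_or_lt with hsr | hsr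
  · subst hsr
    have h1 := hvρ (x := z) ((hγs ▸ hzγ).trans_le ((min_le_right _ _).trans (min_le_right _ _)))
    rw [Real.dist_eq] at h1
    have h2 : 0 ≤ K * ∑ j, (z j - γ s j) ^ 2 := by positivity
    simp only [hΦ₀, hGs] at hle
    linarith [(abs_lt.1 h1).1]
  · exfalso
    have hrab := hsub hr
    have htime : deriv (fun q => v q z) r + (β r (γ r) + A + ε)
        + K * ∑ j, 2 * (z j - γ r j) * (-((y j - x j) / (t - s))) ≤ 0 := by
      have hd : HasDerivAt (fun q => Φ₀ (q, z) + K * ∑ j, (z j - γ q j) ^ 2)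
          (deriv (fun q => v q z) r + (β r (γ r) + A + ε)
            + K * ∑ j, 2 * (z j - γ r j) * (-((y j - x j) / (t - s)))) r := by
        refine HasDerivAt.add (HasDerivAt.add (hvt r hrab z).hasDerivAt
          ((hGd r hr).add ?_)) (HasDerivAt.const_mul K (HasDerivAt.fun_sum fun j _ => ?_))
        · simpa using ((hasDerivAt_id r).sub_const s).const_mul ε
        · simpa using ((hγd r j).const_sub (z j)).fun_pow 2
      exact hd.nonpos_of_forall_le_left hsr
        fun q hq => hmin q ⟨hq.1, hq.2.trans hr.2⟩ z hz
    have hBz : B ∈ 𝓝 z := by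
      refine mem_of_superset (Metric.isOpen_ball.mem_nhds ?_) Metric.ball_subset_closedBall
      refine Metric.mem_ball.2 ((dist_triangle z (γ r) y).trans_lt ?_)
      linarith [hγy r hr, hzγ.trans_le (min_le_left 1 (min ρ₁ ρ₂))]
    have hspace : ∀ j, pd (v r) j z = -(K * (2 * (z j - γ r j))) := by
      intro j
      have hupd : DifferentiableAt ℝ (fun σ => v r (Function.update z j σ)) (z j) :=
        ((hvx r hrab) _).comp (z j) (hasDerivAt_update z j (z j)).differentiableAt
      have hd : HasDerivAt (fun σ => Φ₀ (r, Function.update z j σ)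
          + K * ∑ i, (Function.update z j σ i - γ r i) ^ 2)
          (pd (v r) j z + K * (2 * (z j - γ r j))) (z j) :=
        (hupd.hasDerivAt.add_const (G r + ε * (r - s))).fun_add
          ((hasDerivAt_sum_sq_update_sub z (γ r) j).const_mul K)
      have hloc : IsLocalMin (fun σ => Φ₀ (r, Function.update z j σ)
          + K * ∑ i, (Function.update z j σ i - γ r i) ^ 2) (z j) := by
        have hcont : Tendsto (Function.update z j) (𝓝 (z j)) (𝓝 z) := by
          simpa using (hasDerivAt_update z j (z j)).continuousAt.tendsto
        filter_upwards [hcont hBz] with σ hσ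
        simpa using hmin r hr _ hσ
      linarith [hloc.hasDerivAt_eq_zero hd]
    have hβclose : β r z < β r (γ r) + ε := by
      have := hβρ (r, z) ⟨hr, hz⟩ (r, γ r) (hγQ r hr) (by
        simpa [Prod.dist_eq, hρ₁] using hzγ.trans_le ((min_le_right _ _).trans (min_le_left _ _)))
      rw [Real.dist_eq] at this
      linarith [(abs_lt.1 this).2]
    have hyoung : K * ∑ j, 2 * (z j - γ r j) * (-((y j - x j) / (t - s))) + A
        + ∑ j, pd (v r) j z ^ 2 =
        ∑ j, (pd (v r) j z + (y j - x j) / (2 * (t - s))) ^ 2 := by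
      rw [hA, Finset.mul_sum, Finset.sum_div, ← Finset.sum_add_distrib,
        ← Finset.sum_add_distrib]
      refine Finset.sum_congr rfl fun j _ => ?_
      rw [hspace j]
      field_simp
      ring
    have hnn : 0 ≤ ∑ j, (pd (v r) j z + (y j - x j) / (2 * (t - s))) ^ 2 := by positivity
    linarith [h r hrab z]

/-- The Li–Yau inequality `|∇u|²/u² − ∂_t u/u ≤ β` implies the parabolic Harnack
inequality
`u(s,x) ≤ u(t,y) exp{|x−y|²/(4(t−s)) + (t−s)∫₀¹ β(t+τ(s−t), y+τ(x−y)) dτ}`. -/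
theorem stmt6 (d : ℕ) (T : EReal) (hT : 0 < T)
    (β : ℝ → (Fin d → ℝ) → ℝ)
    (hβ : ContinuousOn (fun p : ℝ × (Fin d → ℝ) => β p.1 p.2)
      {p : ℝ × (Fin d → ℝ) | 0 < p.1 ∧ (p.1 : EReal) < T})
    (u : ℝ → (Fin d → ℝ) → ℝ)
    (hupos : ∀ (t : ℝ) x, 0 < t → (t : EReal) < T → 0 < u t x)
    (huC1t : ∀ x, ContDiffOn ℝ 1 (fun s => u s x) {s : ℝ | 0 < s ∧ (s : EReal) < T})
    (huC1x : ∀ (t : ℝ), 0 < t → (t : EReal) < T → ContDiff ℝ 1 (fun z => u t z))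
    (hLY : ∀ (t : ℝ) x, 0 < t → (t : EReal) < T →
      (∑ j, (pd (fun z => u t z) j x) ^ 2) / (u t x) ^ 2
          - deriv (fun s => u s x) t / u t x ≤ β t x) :
    ∀ (s t : ℝ) (x y : Fin d → ℝ), 0 < s → s < t → (t : EReal) < T →
      u s x ≤ u t y * Real.exp ((∑ j, (x j - y j) ^ 2) / (4 * (t - s))
        + (t - s) * ∫ τ in (0 : ℝ)..(1 : ℝ), β (t + τ * (s - t)) (y + τ • (x - y))) := by
  intro s t x y hs hst htT
  obtain ⟨b, htb, hbT⟩ := EReal.lt_iff_exists_real_btwn.1 htT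
  replace htb : t < b := by exact_mod_cast htb
  have hI : ∀ r ∈ Ioo 0 b, 0 < r ∧ (r : EReal) < T := fun r hr =>
    ⟨hr.1, (EReal.coe_lt_coe hr.2).trans hbT⟩
  have hut : ∀ r ∈ Ioo 0 b, ∀ z, DifferentiableAt ℝ (fun q => u q z) r := fun r hr z =>
    ((huC1t z).differentiableOn one_ne_zero).differentiableAt
      (mem_of_superset (Ioo_mem_nhds hr.1 hr.2) hI)
  have hux : ∀ r ∈ Ioo 0 b, Differentiable ℝ (u r) := fun r hr =>
    (huC1x r (hI r hr).1 (hI r hr).2).differentiable one_ne_zero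
  have hu0 : ∀ r ∈ Ioo 0 b, ∀ z, 0 < u r z := fun r hr z => hupos r z (hI r hr).1 (hI r hr).2
  have hpd : ∀ r ∈ Ioo 0 b, ∀ z j,
      pd (fun z => Real.log (u r z)) j z = pd (u r) j z / u r z := by
    intro r hr z j
    have hupd : DifferentiableAt ℝ (fun σ => u r (Function.update z j σ)) (z j) :=
      ((hux r hr) _).comp (z j) (hasDerivAt_update z j (z j)).differentiableAt
    simpa [pd] using (hupd.hasDerivAt.log (hu0 r hr _).ne').deriv
  have key := le_add_integral_of_sum_sq_pd_sub_deriv_le hs hst htb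
    (v := fun r z => Real.log (u r z)) (hβ.mono fun p hp => hI p.1 hp.1)
    (fun r hr z => (hut r hr z).log (hu0 r hr z).ne')
    (fun r hr z => ((hux r hr) z).log (hu0 r hr z).ne')
    (fun r hr z => by
      rw [((hut r hr z).hasDerivAt.log (hu0 r hr z).ne').deriv]
      simp only [hpd r hr z, div_pow, ← Finset.sum_div]
      exact hLY r z (hI r hr).1 (hI r hr).2) x y
  have hint : (t - s) * ∫ τ in (0 : ℝ)..(1 : ℝ), β (t + τ * (s - t)) (y + τ • (x - y)) =
      ∫ r in s..t, β r (y + ((t - r) / (t - s)) • (x - y)) := by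
    have hts : t - s ≠ 0 := (sub_pos.2 hst).ne'
    have := intervalIntegral.smul_integral_comp_add_mul (a := 0) (b := 1)
      (fun r => β r (y + ((t - r) / (t - s)) • (x - y))) (s - t) t
    simp only [mul_zero, add_zero, mul_one, add_sub_cancel, smul_eq_mul] at this
    rw [intervalIntegral.integral_symm t s, ← this, ← neg_mul, neg_sub]
    congr 2
    ext τ
    rw [mul_comm τ, show (t - (t + (s - t) * τ)) / (t - s) = τ by field_simp; ring]
  have hs0 := hu0 s ⟨hs, hst.trans htb⟩ x
  have ht0 := hu0 t ⟨hs.trans hst, htb⟩ y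
  rw [hint, ← Real.log_le_log_iff hs0 (by positivity),
    Real.log_mul ht0.ne' (Real.exp_pos _).ne', Real.log_exp]
  exact key
end

section
/- Let h : ℝ^d × ℝ^d → (0,∞) and f : ℝ^d → [0,∞) be measurable, and suppose u(z) := ∫_{ℝ^d} f(y) h(z,y) dμ_κ(y) is finite and positive at the point x and at every reflected point σ_α x, α ∈ R₊, where ⟨α,x⟩ ≠ 0 for every α ∈ R₊. Then ∫_{ℝ^d} Π_log(h(·,y))(x) h(x,y) f(y) dμ_κ(y) ≤ u(x) Π_log(u)(x), where for a positive function v, Π_log(v)(x) = 2 Σ_{α∈R₊} κ_α ( log(v(σ_α x)/v(x)) − v(σ_α x)/v(x) + 1 ) / ⟨α,x⟩². -/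
open Real MeasureTheory

/-- `Π_log(v)(x) = 2 Σ_{α∈R₊} κ_α (log(v(σ_α x)/v(x)) − v(σ_α x)/v(x) + 1)/⟨α,x⟩²`. -/
noncomputable def PiLog {d : ℕ} (Rp : Finset (Fin d → ℝ)) (κ : (Fin d → ℝ) → ℝ)
    (v : (Fin d → ℝ) → ℝ) (x : Fin d → ℝ) : ℝ :=
  2 * ∑ α ∈ Rp, κ α *
    ((Real.log (v (reflAlpha α x) / v x) - v (reflAlpha α x) / v x + 1)
      / (∑ i, α i * x i) ^ 2)

/-- The tangent line inequality for `t ↦ log t - t + 1` at `t = a`, at `t = q / p`, scaled by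
`p * c`. -/
lemma log_div_sub_div_add_one_mul_le {a p q c : ℝ} (ha : 0 < a) (hp : 0 < p) (hq : 0 < q)
    (hc : 0 ≤ c) :
    (Real.log (q / p) - q / p + 1) * (p * c) ≤
      Real.log a * (c * p) + (a⁻¹ - 1) * (c * q) := by
  have htangent := Real.log_le_sub_one_of_pos (div_pos (div_pos hq hp) ha)
  rw [Real.log_div (div_pos hq hp).ne' ha.ne'] at htangent
  have hle : Real.log (q / p) - q / p + 1 ≤ Real.log a + (a⁻¹ - 1) * (q / p) := by
    have : q / p / a = a⁻¹ * (q / p) := by ring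
    linarith
  calc (Real.log (q / p) - q / p + 1) * (p * c)
      ≤ (Real.log a + (a⁻¹ - 1) * (q / p)) * (p * c) :=
        mul_le_mul_of_nonneg_right hle (by positivity)
    _ = Real.log a * (c * p) + (a⁻¹ - 1) * (c * q) := by field_simp

/-- The key convexity inequality:
`∫ Π_log(h(·,y))(x) h(x,y) f(y) dμ_κ(y) ≤ u(x) Π_log(u)(x)` for
`u(z) = ∫ f(y) h(z,y) dμ_κ(y)`. -/
theorem stmt11 (d : ℕ) (Rp : Finset (Fin d → ℝ))
    (hRp : ∀ α ∈ Rp, ∑ i, (α i) ^ 2 = 2)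
    (κ : (Fin d → ℝ) → ℝ) (hκ : ∀ α ∈ Rp, 0 ≤ κ α)
    (h : (Fin d → ℝ) → (Fin d → ℝ) → ℝ)
    (hhmeas : Measurable (Function.uncurry h)) (hhpos : ∀ z y, 0 < h z y)
    (f : (Fin d → ℝ) → ℝ) (hfmeas : Measurable f) (hfnonneg : ∀ y, 0 ≤ f y)
    (x : Fin d → ℝ) (hx : ∀ α ∈ Rp, (∑ i, α i * x i) ≠ 0)
    -- `u` is finite and positive at `x` and at every reflected point `σ_α x`
    (hintx : Integrable (fun y => f y * h x y) (dunklMeasure Rp κ))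
    (hposx : 0 < ∫ y, f y * h x y ∂(dunklMeasure Rp κ))
    (hintr : ∀ α ∈ Rp, Integrable (fun y => f y * h (reflAlpha α x) y) (dunklMeasure Rp κ))
    (hposr : ∀ α ∈ Rp, 0 < ∫ y, f y * h (reflAlpha α x) y ∂(dunklMeasure Rp κ))
    -- absolute convergence of the left-hand side
    (hintL : Integrable (fun y => PiLog Rp κ (fun z => h z y) x * h x y * f y)
      (dunklMeasure Rp κ)) :
    ∫ y, PiLog Rp κ (fun z => h z y) x * h x y * f y ∂(dunklMeasure Rp κ)
      ≤ (∫ y, f y * h x y ∂(dunklMeasure Rp κ))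
        * PiLog Rp κ (fun z => ∫ y, f y * h z y ∂(dunklMeasure Rp κ)) x := by
  set ν := dunklMeasure Rp κ
  set u : (Fin d → ℝ) → ℝ := fun z => ∫ y, f y * h z y ∂ν
  let g : (Fin d → ℝ) → (Fin d → ℝ) → ℝ := fun α y =>
    κ α / (∑ i, α i * x i) ^ 2 *
      (Real.log (u (reflAlpha α x) / u x) * (f y * h x y) +
        ((u (reflAlpha α x) / u x)⁻¹ - 1) * (f y * h (reflAlpha α x) y))
  have hg : ∀ α ∈ Rp, Integrable (g α) ν := fun α hα =>
    ((hintx.const_mul _).add ((hintr α hα).const_mul _)).const_mul _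
  have hg_integral : ∫ y, 2 * ∑ α ∈ Rp, g α y ∂ν = u x * PiLog Rp κ u x := by
    rw [integral_const_mul, integral_finsetSum _ hg, PiLog, mul_left_comm, Finset.mul_sum _ _ (u x)]
    congr 1
    refine Finset.sum_congr rfl fun α hα => ?_
    have hux : u x ≠ 0 := hposx.ne'
    have hur : u (reflAlpha α x) ≠ 0 := (hposr α hα).ne'
    have hαx := hx α hα
    rw [integral_const_mul, integral_add (hintx.const_mul _) ((hintr α hα).const_mul _),
      integral_const_mul, integral_const_mul]
    change κ α / (∑ i, α i * x i) ^ 2 *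
      (Real.log (u (reflAlpha α x) / u x) * u x +
        ((u (reflAlpha α x) / u x)⁻¹ - 1) * u (reflAlpha α x)) = _
    generalize Real.log (u (reflAlpha α x) / u x) = l
    field_simp
    ring
  rw [← hg_integral]
  refine integral_mono hintL ((integrable_finsetSum _ hg).const_mul 2) fun y => ?_
  simp only [PiLog]
  rw [mul_assoc, mul_assoc, Finset.sum_mul]
  refine mul_le_mul_of_nonneg_left (Finset.sum_le_sum fun α hα => ?_) zero_le_two
  have hweight : 0 ≤ κ α / (∑ i, α i * x i) ^ 2 := div_nonneg (hκ α hα) (sq_nonneg _)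
  refine le_trans (le_of_eq ?_) (mul_le_mul_of_nonneg_left
    (log_div_sub_div_add_one_mul_le (div_pos (hposr α hα) hposx) (hhpos x y)
      (hhpos (reflAlpha α x) y) (hfnonneg y)) hweight)
  ring
end
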